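/- Let A be a rational map of the Riemann sphere of degree d ≥ 2 which is not conjugate to z ↦ z^d, z ↦ z^{−d}, T_d, or −T_d. Then there exists an orbifold O₀^A on ℂP¹ such that A : O₀^A → O₀^A is a minimal holomorphic map between orbifolds, and such that for every orbifold O for which A : O → O is a minimal holomorphic map between orbifolds one has O ⪯ O₀^A. Furthermore, for every l ≥ 1 the analogous maximal orbifold O₀^{A^{∘l}} for the iterate A^{∘l} exists and is equal to O₀^A. -/

import Mathlib

open Polynomial OnePoint
open scoped Classical

noncomputable section

namespace GenLattes

/-- Composition of rational functions: `rcomp f g = f ∘ g`. -/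
def rcomp (f g : RatFunc ℂ) : RatFunc ℂ :=
  Polynomial.aeval g f.num / Polynomial.aeval g f.denom

/-- The degree of a rational function: the maximum of the degrees of its numerator and
denominator in lowest terms. -/
def rdeg (f : RatFunc ℂ) : ℕ := max f.num.natDegree f.denom.natDegree

/-- Evaluation of a rational function at a finite point, with value in the Riemann
sphere `ℂP¹ = OnePoint ℂ`. -/
def evalF (f : RatFunc ℂ) (z : ℂ) : OnePoint ℂ :=
  if f.denom.eval z = 0 then ∞ else ((f.num.eval z / f.denom.eval z : ℂ) : OnePoint ℂ)

/-- The local degree (local multiplicity) of a rational function at a finite point. -/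
def locDegF (f : RatFunc ℂ) (z : ℂ) : ℕ :=
  if f.denom.eval z = 0 then rootMultiplicity z f.denom
  else rootMultiplicity z (f.num - Polynomial.C (f.num.eval z / f.denom.eval z) * f.denom)

/-- The rational function `f(1/X)`. -/
def flip (f : RatFunc ℂ) : RatFunc ℂ := rcomp f (RatFunc.X)⁻¹

/-- The self-map of the Riemann sphere `ℂP¹ = OnePoint ℂ` induced by a rational function. -/
def evalOP (f : RatFunc ℂ) (x : OnePoint ℂ) : OnePoint ℂ :=
  OnePoint.rec (evalF (flip f) 0) (fun z => evalF f z) x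

/-- The local degree `deg_x f` of a rational function at a point of the Riemann sphere. -/
def locDeg (f : RatFunc ℂ) (x : OnePoint ℂ) : ℕ :=
  OnePoint.rec (locDegF (flip f) 0) (fun z => locDegF f z) x

/-- The iterate `f^{∘l}` of a rational function (with `riter f 0 = X = id`). -/
def riter (f : RatFunc ℂ) : ℕ → RatFunc ℂ
  | 0 => RatFunc.X
  | l + 1 => rcomp f (riter f l)

/-- An orbifold on the Riemann sphere: a ramification function `ν : ℂP¹ → ℕ` with
`ν(z) ≥ 1` everywhere and `ν(z) = 1` outside a finite set. -/
structure Orbifold where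
  nu : OnePoint ℂ → ℕ
  one_le : ∀ z, 1 ≤ nu z
  finite : {z : OnePoint ℂ | nu z ≠ 1}.Finite

/-- A good orbifold: it is forbidden to have exactly one point with `ν > 1`, or exactly
two such points with different values of `ν`. -/
def Orbifold.Good (O : Orbifold) : Prop :=
  (¬ ∃ z, {w : OnePoint ℂ | O.nu w ≠ 1} = {z}) ∧
  (¬ ∃ z₁ z₂, z₁ ≠ z₂ ∧ {w : OnePoint ℂ | O.nu w ≠ 1} = {z₁, z₂} ∧ O.nu z₁ ≠ O.nu z₂)

/-- A nontrivial orbifold (distinct from the non-ramified sphere). -/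
def Orbifold.IsNontrivial (O : Orbifold) : Prop := ∃ z, 1 < O.nu z

/-- The relation `O₁ ⪯ O₂`: pointwise divisibility of ramification functions. -/
def Orbifold.Prec (O₁ O₂ : Orbifold) : Prop := ∀ z, O₁.nu z ∣ O₂.nu z

/-- The signature of an orbifold: the multiset of values of `ν` on `c(O) = {ν > 1}`. -/
def Orbifold.signature (O : Orbifold) : Multiset ℕ := O.finite.toFinset.val.map O.nu

/-- The Euler characteristic `χ(O) = 2 + Σ (1/ν(z) - 1)`. -/
def Orbifold.eulerChar (O : Orbifold) : ℚ :=
  2 + ∑ z ∈ O.finite.toFinset, ((O.nu z : ℚ)⁻¹ - 1)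

/-- `A : O₁ → O₂` is a holomorphic map between orbifolds:
`ν₂(A(z)) ∣ ν₁(z)·deg_z A` for all `z`. -/
def IsHolo (A : RatFunc ℂ) (O₁ O₂ : Orbifold) : Prop :=
  ∀ z, O₂.nu (evalOP A z) ∣ O₁.nu z * locDeg A z

/-- `A : O₁ → O₂` is a minimal holomorphic map between orbifolds:
`ν₂(A(z)) = ν₁(z)·gcd(deg_z A, ν₂(A(z)))` for all `z`. -/
def IsMinHolo (A : RatFunc ℂ) (O₁ O₂ : Orbifold) : Prop :=
  ∀ z, O₂.nu (evalOP A z) = O₁.nu z * Nat.gcd (locDeg A z) (O₂.nu (evalOP A z))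

/-- `A : O₁ → O₂` is a covering map between orbifolds:
`ν₂(A(z)) = ν₁(z)·deg_z A` for all `z`. -/
def IsCovering (A : RatFunc ℂ) (O₁ O₂ : Orbifold) : Prop :=
  ∀ z, O₂.nu (evalOP A z) = O₁.nu z * locDeg A z

/-- `A` and `B` are conjugate by a Möbius transformation: `A = μ ∘ B ∘ μ⁻¹`. -/
def Conjugate (A B : RatFunc ℂ) : Prop :=
  ∃ μ ν : RatFunc ℂ, rcomp μ ν = RatFunc.X ∧ rcomp ν μ = RatFunc.X ∧
    A = rcomp (rcomp μ B) ν

/-- The Chebyshev polynomial `T_d` viewed as a rational function. -/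
def chebyRF (d : ℕ) : RatFunc ℂ :=
  algebraMap (Polynomial ℂ) (RatFunc ℂ) (Polynomial.Chebyshev.T ℂ d)

end GenLattes

namespace GenLattes

/-- The combinatorial data of a map `f` of degree `d` with local degrees `e`: fibres counted with
multiplicity have `d` elements, and the Riemann-Hurwitz inequality holds. -/
structure BranchData (f : OnePoint ℂ → OnePoint ℂ) (e : OnePoint ℂ → ℕ) (d : ℕ) : Prop where
  two_le : 2 ≤ d
  one_le : ∀ z, 1 ≤ e z
  fiber : ∀ c, ∃ F : Finset (OnePoint ℂ), (∀ z, z ∈ F ↔ f z = c) ∧ ∑ z ∈ F, e z = d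
  ram : ∀ T : Finset (OnePoint ℂ), ∑ z ∈ T, (e z - 1) ≤ 2 * (d - 1)

/-- A pair of distinct totally ramified points that is mapped to itself. -/
def PowerConfig (f : OnePoint ℂ → OnePoint ℂ) (e : OnePoint ℂ → ℕ) (d : ℕ) : Prop :=
  ∃ a b, a ≠ b ∧ e a = d ∧ e b = d ∧ (f a = a ∨ f a = b) ∧ (f b = a ∨ f b = b)

/-- The ramification pattern of the Chebyshev polynomials up to sign. -/
def ChebyConfig (f : OnePoint ℂ → OnePoint ℂ) (e : OnePoint ℂ → ℕ) (d : ℕ) : Prop :=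
  ∃ c a b, a ≠ b ∧ a ≠ c ∧ b ≠ c ∧ f c = c ∧ e c = d ∧
    ∀ z, (z = a ∨ z = b → (f z = a ∨ f z = b) ∧ e z = 1) ∧
      ((f z = a ∨ f z = b) → (z = a ∨ z = b) ∨ e z = 2)

/-- The functional form of minimality of `f : (P¹, ν₁) → (P¹, ν₂)`. -/
def MinFun (f : OnePoint ℂ → OnePoint ℂ) (e ν₁ ν₂ : OnePoint ℂ → ℕ) : Prop :=
  ∀ z, ν₁ z * e z = Nat.lcm (ν₂ (f z)) (e z)

lemma minFun_iff_isMinHolo (A : RatFunc ℂ) (he : ∀ z, 1 ≤ locDeg A z) (O₁ O₂ : Orbifold) :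
    MinFun (evalOP A) (locDeg A) O₁.nu O₂.nu ↔ IsMinHolo A O₁ O₂ := by
  refine forall_congr' fun z => ?_
  have h1 := O₂.one_le (evalOP A z)
  have h2 := he z
  generalize O₂.nu (evalOP A z) = a at *
  generalize locDeg A z = k at *
  generalize O₁.nu z = n
  have hg : 0 < Nat.gcd k a := Nat.gcd_pos_of_pos_left _ h2
  have hm : Nat.gcd k a * Nat.lcm a k = a * k := by rw [Nat.gcd_comm, Nat.gcd_mul_lcm]
  constructor
  · intro h
    rw [← h] at hm
    apply Nat.eq_of_mul_eq_mul_right h2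
    rw [← hm]; ring
  · intro h
    apply Nat.eq_of_mul_eq_mul_left hg
    rw [hm]
    rw [show Nat.gcd k a * (n * k) = n * Nat.gcd k a * k by ring, ← h]

lemma MinFun.lcm {f : OnePoint ℂ → OnePoint ℂ} {e ν₁ ν₂ μ₁ μ₂ : OnePoint ℂ → ℕ}
    (h : MinFun f e ν₁ ν₂) (h' : MinFun f e μ₁ μ₂) :
    MinFun f e (fun z => Nat.lcm (ν₁ z) (μ₁ z)) (fun z => Nat.lcm (ν₂ z) (μ₂ z)) := by
  intro z
  simp only
  rw [← Nat.lcm_mul_right, h z, h' z]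
  apply Nat.dvd_antisymm
  · refine Nat.lcm_dvd (Nat.lcm_dvd ?_ ?_) (Nat.lcm_dvd ?_ ?_) <;>
    first
    | exact Nat.dvd_lcm_right _ _
    | exact (Nat.dvd_lcm_left _ _).trans (Nat.dvd_lcm_left _ _)
    | exact (Nat.dvd_lcm_right _ _).trans (Nat.dvd_lcm_left _ _)
  · refine Nat.lcm_dvd (Nat.lcm_dvd ?_ ?_) ?_
    · exact (Nat.dvd_lcm_left _ _).trans (Nat.dvd_lcm_left _ _)
    · exact (Nat.dvd_lcm_left _ _).trans (Nat.dvd_lcm_right _ _)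
    · exact (Nat.dvd_lcm_right _ _).trans (Nat.dvd_lcm_left _ _)

lemma MinFun.comp {f g : OnePoint ℂ → OnePoint ℂ} {e k ν₁ ν₂ ν₃ : OnePoint ℂ → ℕ}
    (h : MinFun f e ν₂ ν₃) (h' : MinFun g k ν₁ ν₂) :
    MinFun (fun z => f (g z)) (fun z => e (g z) * k z) ν₁ ν₃ := by
  intro z
  have h1 := h (g z)
  have h2 := h' z
  simp only
  rw [show ν₁ z * (e (g z) * k z) = (ν₁ z * k z) * e (g z) by ring, h2, ← Nat.lcm_mul_right, h1]
  apply Nat.dvd_antisymm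
  · refine Nat.lcm_dvd (Nat.lcm_dvd (Nat.dvd_lcm_left _ _) ?_) ?_
    · exact (Dvd.intro _ rfl).trans (Nat.dvd_lcm_right _ _)
    · rw [mul_comm]; exact Nat.dvd_lcm_right _ _
  · refine Nat.lcm_dvd ?_ ?_
    · exact (Nat.dvd_lcm_left _ _).trans (Nat.dvd_lcm_left _ _)
    · rw [mul_comm]; exact Nat.dvd_lcm_right _ _

namespace BranchData

variable {f : OnePoint ℂ → OnePoint ℂ} {e : OnePoint ℂ → ℕ} {d : ℕ}

lemma preimage (H : BranchData f e d) (S : Finset (OnePoint ℂ)) :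
    ∃ T : Finset (OnePoint ℂ), (∀ z, z ∈ T ↔ f z ∈ S) ∧ ∑ z ∈ T, e z = d * S.card := by
  choose F hF hs using H.fiber
  refine ⟨S.biUnion F, fun z => by simp [hF], ?_⟩
  rw [Finset.sum_biUnion]
  · simp [hs, mul_comm]
  · intro x _ y _ hxy
    rw [Function.onFun, Finset.disjoint_left]
    intro z hz hz'
    rw [hF] at hz hz'
    exact hxy (hz.symm.trans hz')

lemma sum_eq (H : BranchData f e d) (T : Finset (OnePoint ℂ)) :
    ∑ z ∈ T, e z = ∑ z ∈ T, (e z - 1) + T.card := by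
  rw [Finset.card_eq_sum_ones, ← Finset.sum_add_distrib]
  exact Finset.sum_congr rfl fun z _ => by have := H.one_le z; omega

lemma le_deg (H : BranchData f e d) (z : OnePoint ℂ) : e z ≤ d := by
  obtain ⟨F, hF, hs⟩ := H.fiber (f z)
  rw [← hs]
  exact Finset.single_le_sum (f := e) (fun _ _ => Nat.zero_le _) ((hF z).2 rfl)

lemma eq_of_deg (H : BranchData f e d) {a z : OnePoint ℂ} (ha : e a = d) (hz : f z = f a) :
    z = a := by
  by_contra hne
  obtain ⟨F, hF, hs⟩ := H.fiber (f a)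
  have : ∑ w ∈ ({z, a} : Finset (OnePoint ℂ)), e w ≤ ∑ w ∈ F, e w :=
    Finset.sum_le_sum_of_subset (by
      intro w
      simp only [Finset.mem_insert, Finset.mem_singleton]
      rintro (rfl | rfl) <;> simp [hF, hz])
  rw [Finset.sum_pair hne, hs] at this
  have := H.one_le z
  omega

lemma nu_dvd {ν₁ ν₂ : OnePoint ℂ → ℕ} (H : BranchData f e d) (h : MinFun f e ν₁ ν₂)
    (z : OnePoint ℂ) : ν₁ z ∣ ν₂ (f z) := by
  have hpos := H.one_le z
  refine Nat.dvd_of_mul_dvd_mul_right hpos ?_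
  rw [h z]
  exact Nat.lcm_dvd (Dvd.intro _ rfl) (Dvd.intro_left _ rfl)

lemma dvd_deg {ν₁ ν₂ : OnePoint ℂ → ℕ} (h : MinFun f e ν₁ ν₂)
    {z : OnePoint ℂ} (hz : ν₁ z = 1) : ν₂ (f z) ∣ e z := by
  have := h z
  rw [hz, one_mul] at this
  rw [this]
  exact Nat.dvd_lcm_left _ _

lemma nu_le {ν₁ ν₂ : OnePoint ℂ → ℕ} (H : BranchData f e d) (h : MinFun f e ν₁ ν₂)
    {z : OnePoint ℂ} (h1 : 1 ≤ ν₁ z) : ν₂ (f z) ≤ ν₁ z * d :=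
  calc ν₂ (f z) ≤ Nat.lcm (ν₂ (f z)) (e z) := by
        refine Nat.le_of_dvd ?_ (Nat.dvd_lcm_left _ _)
        rw [← h z]
        exact Nat.mul_pos h1 (H.one_le z)
    _ = ν₁ z * e z := (h z).symm
    _ ≤ _ := Nat.mul_le_mul_left _ (H.le_deg z)

/-- The support of an invariant orbifold has at most four points. -/
lemma card_support_le (H : BranchData f e d) (O : Orbifold) (h : MinFun f e O.nu O.nu) :
    O.finite.toFinset.card ≤ 4 := by
  set S := O.finite.toFinset with hS
  have hmem : ∀ z, z ∈ S ↔ O.nu z ≠ 1 := by intro z; simp [hS]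
  obtain ⟨T, hT, hsum⟩ := H.preimage S
  have hST : S ⊆ T := by
    intro z hz
    rw [hT, hmem]
    rw [hmem] at hz
    intro h1
    exact hz (Nat.dvd_one.1 (h1 ▸ H.nu_dvd h z))
  have h1 : (T \ S).card ≤ ∑ z ∈ T \ S, (e z - 1) := by
    rw [Finset.card_eq_sum_ones]
    refine Finset.sum_le_sum fun z hz => ?_
    rw [Finset.mem_sdiff, hT, hmem, hmem, not_not] at hz
    have h2 := dvd_deg h hz.2
    have h3 := H.one_le z
    have h4 := Nat.le_of_dvd h3 h2
    have h5 := O.one_le (f z)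
    omega
  have h2 := H.ram (T \ S)
  have h3 := H.ram T
  have h4 := H.sum_eq T
  have h5 := Finset.card_sdiff_add_card_eq_card hST
  have h6 := H.two_le
  rw [hsum] at h4
  by_contra hcon
  push Not at hcon
  obtain ⟨m, rfl⟩ : ∃ m, d = m + 1 := ⟨d - 1, by omega⟩
  have : m * 5 ≤ m * S.card := Nat.mul_le_mul_left _ hcon
  rw [add_mul, one_mul] at h4
  simp only [Nat.add_sub_cancel] at *
  omega

/-- A point of large ramification index is a totally ramified fixed point. -/
lemma fixed_of_large (H : BranchData f e d) (hP : ¬ PowerConfig f e d) (O : Orbifold)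
    (h : MinFun f e O.nu O.nu) {c : OnePoint ℂ} (hc : d ^ 4 < O.nu c) : f c = c ∧ e c = d := by
  set V : ℕ → Finset (OnePoint ℂ) := fun k => O.finite.toFinset.filter fun z => d ^ k < O.nu z
    with hV
  have hd := H.two_le
  have hmem : ∀ k z, z ∈ V k ↔ d ^ k < O.nu z := by
    intro k z
    simp only [hV, Finset.mem_filter, Set.Finite.mem_toFinset, Set.mem_ofPred_eq,
      and_iff_right_iff_imp]
    intro h1
    have : 1 ≤ d ^ k := Nat.one_le_pow _ _ (by omega)
    omega
  have hanti : ∀ k, V (k + 1) ⊆ V k := by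
    intro k z hz
    rw [hmem] at *
    exact lt_of_le_of_lt (Nat.pow_le_pow_right (by omega) (Nat.le_succ k)) hz
  have hstep : ∀ k z, f z ∈ V (k + 1) → z ∈ V k := by
    intro k z hz
    rw [hmem] at *
    have := H.nu_le h (O.one_le z)
    rw [pow_succ] at hz
    exact lt_of_mul_lt_mul_right (lt_of_lt_of_le hz this) (Nat.zero_le _)
  have h0 : (V 0).card ≤ 4 := (Finset.card_filter_le _ _).trans (H.card_support_le O h)
  have h4 : 1 ≤ (V 4).card := Finset.card_pos.2 ⟨c, (hmem 4 c).2 hc⟩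
  obtain ⟨k, hk, hVk⟩ : ∃ k, k < 4 ∧ V (k + 1) = V k := by
    by_contra hcon
    push Not at hcon
    have key : ∀ k, k < 4 → (V (k + 1)).card < (V k).card := fun k hk =>
      Finset.card_lt_card ((hanti k).ssubset_of_ne (hcon k hk))
    have a := key 0 (by norm_num)
    have b := key 1 (by norm_num)
    have c := key 2 (by norm_num)
    have d := key 3 (by norm_num)
    norm_num at a b c d
    omega
  set B := V (k + 1) with hB
  have hcB : c ∈ B := by
    rw [hB, hmem]
    exact lt_of_le_of_lt (Nat.pow_le_pow_right (by omega) (by omega)) hc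
  obtain ⟨T, hT, hsum⟩ := H.preimage B
  have hTB : T ⊆ B := by
    intro z hz
    rw [hVk]
    exact hstep k z ((hT z).1 hz)
  have hle : ∑ z ∈ T, e z ≤ T.card * d := by
    simpa using Finset.sum_le_card_nsmul T e d fun z _ => H.le_deg z
  have hTB' : T = B := by
    refine Finset.eq_of_subset_of_card_le hTB ?_
    rw [hsum, mul_comm] at hle
    exact Nat.le_of_mul_le_mul_right hle (by omega)
  rw [hTB'] at hsum hT
  have hed : ∀ z ∈ B, e z = d := by
    have := (Finset.sum_eq_sum_iff_of_le (f := e) (g := fun _ => d) (s := B)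
      fun z _ => H.le_deg z).1 (by simp [hsum, mul_comm])
    exact this
  have hcard : B.card ≤ 2 := by
    have h1 := H.ram B
    rw [Finset.sum_congr rfl (g := fun _ => d - 1) fun z hz => by rw [hed z hz]] at h1
    simp only [Finset.sum_const, smul_eq_mul] at h1
    exact Nat.le_of_mul_le_mul_right h1 (by omega)
  refine ⟨?_, hed c hcB⟩
  by_contra hne
  have hfc : f c ∈ B := (hT c).1 hcB
  have hsub : ({c, f c} : Finset (OnePoint ℂ)) ⊆ B := by
    intro w; simp only [Finset.mem_insert, Finset.mem_singleton]; rintro (rfl | rfl) <;> assumption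
  have hB2 : ({c, f c} : Finset (OnePoint ℂ)) = B :=
    Finset.eq_of_subset_of_card_le hsub (by rwa [Finset.card_pair (Ne.symm hne)])
  have hffc : f (f c) ∈ B := (hT _).1 hfc
  rw [← hB2] at hffc
  exact hP ⟨c, f c, Ne.symm hne, hed _ hcB, hed _ hfc, Or.inr rfl, by simpa using hffc⟩

/-- Besides a totally ramified fixed point, the support of an invariant orbifold has at most one
point, unless the ramification pattern is that of a Chebyshev polynomial. -/
lemma card_support_erase_le (H : BranchData f e d) (hC : ¬ ChebyConfig f e d) (O : Orbifold)
    (h : MinFun f e O.nu O.nu) {c : OnePoint ℂ} (hfc : f c = c) (hec : e c = d) :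
    (O.finite.toFinset.erase c).card ≤ 1 := by
  set S := O.finite.toFinset.erase c with hS
  have hmem : ∀ z, z ∈ S ↔ z ≠ c ∧ O.nu z ≠ 1 := by intro z; simp [hS]
  have hfz : ∀ z, f z = c → z = c := fun z hz => H.eq_of_deg hec (hz.trans hfc.symm)
  obtain ⟨T, hT, hsum⟩ := H.preimage S
  have hST : S ⊆ T := by
    intro z hz
    rw [hT, hmem]
    rw [hmem] at hz
    refine ⟨fun h1 => hz.1 (hfz z h1), fun h1 => hz.2 (Nat.dvd_one.1 (h1 ▸ H.nu_dvd h z))⟩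
  have hcT : c ∉ T := by
    rw [hT, hfc, hmem]; simp
  have hpos : ∀ z ∈ T \ S, 1 ≤ e z - 1 := by
    intro z hz
    rw [Finset.mem_sdiff, hT, hmem, hmem] at hz
    have hzc : z ≠ c := by rintro rfl; exact hz.1.1 hfc
    have h1 : O.nu z = 1 := by tauto
    have h2 := dvd_deg h h1
    have h4 := Nat.le_of_dvd (H.one_le z) h2
    have h5 := O.one_le (f z)
    have h6 := hz.1.2
    omega
  have h1 : (T \ S).card ≤ ∑ z ∈ T \ S, (e z - 1) := by
    rw [Finset.card_eq_sum_ones]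
    exact Finset.sum_le_sum hpos
  have h2 := H.ram (insert c T)
  rw [Finset.sum_insert hcT, hec] at h2
  have h3 := Finset.sum_sdiff (f := fun z => e z - 1) hST
  have h4 := H.sum_eq T
  have h5 := Finset.card_sdiff_add_card_eq_card hST
  have h6 := H.two_le
  rw [hsum] at h4
  by_contra hcon
  push Not at hcon
  obtain ⟨m, rfl⟩ : ∃ m, d = m + 1 := ⟨d - 1, by omega⟩
  rw [add_mul, one_mul] at h4
  simp only [Nat.add_sub_cancel] at h2
  have hle : S.card ≤ 2 := by
    by_contra hcon
    push Not at hcon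
    have : m * 3 ≤ m * S.card := Nat.mul_le_mul_left _ hcon
    omega
  have hc2 : S.card = 2 := by omega
  rw [hc2] at h4 h5
  have hS0 : ∑ z ∈ S, (e z - 1) = 0 := by omega
  have hTS : ∑ z ∈ T \ S, 1 = ∑ z ∈ T \ S, (e z - 1) := by
    rw [← Finset.card_eq_sum_ones]; omega
  have hone := (Finset.sum_eq_sum_iff_of_le hpos).1 hTS
  rw [Finset.sum_eq_zero_iff] at hS0
  obtain ⟨a, b, hab, hSab⟩ := Finset.card_eq_two.1 hc2
  have hSm : ∀ z, z ∈ S ↔ z = a ∨ z = b := by intro z; rw [hSab]; simp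
  have ha := (hSm a).2 (Or.inl rfl)
  have hb := (hSm b).2 (Or.inr rfl)
  refine hC ⟨c, a, b, hab, ((hmem a).1 ha).1, ((hmem b).1 hb).1, hfc, hec, fun z => ⟨?_, ?_⟩⟩
  · intro hz
    rw [← hSm] at hz
    refine ⟨(hSm _).1 ((hT z).1 (hST hz)), ?_⟩
    have := hS0 z hz
    have := H.one_le z
    omega
  · intro hz
    rw [← hSm, ← hT] at hz
    by_cases hzS : z ∈ S
    · exact Or.inl ((hSm z).1 hzS)
    · have := hone z (Finset.mem_sdiff.2 ⟨hz, hzS⟩)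
      right; omega

/-- The ramification indices of a good invariant orbifold are bounded. -/
lemma nu_le_of_good (H : BranchData f e d) (hP : ¬ PowerConfig f e d) (hC : ¬ ChebyConfig f e d)
    (O : Orbifold) (hO : O.Good) (h : MinFun f e O.nu O.nu) (c : OnePoint ℂ) :
    O.nu c ≤ d ^ 4 := by
  by_contra hc
  push Not at hc
  obtain ⟨hfc, hec⟩ := H.fixed_of_large hP O h hc
  have hd : 1 ≤ d ^ 4 := Nat.one_le_pow _ _ (by have := H.two_le; omega)
  have hcS : O.nu c ≠ 1 := by omega
  have hcard := H.card_support_erase_le hC O h hfc hec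
  rw [Finset.card_le_one_iff_subset_singleton] at hcard
  obtain ⟨z, hz⟩ := hcard
  have hmem : ∀ w, O.nu w ≠ 1 → w = c ∨ w = z := by
    intro w hw
    by_cases hwc : w = c
    · exact Or.inl hwc
    · right
      exact Finset.mem_singleton.1 (hz (by simp [hwc, hw]))
  by_cases hz1 : z = c ∨ O.nu z = 1
  · refine hO.1 ⟨c, ?_⟩
    ext w
    simp only [Set.mem_ofPred_eq, Set.mem_singleton_iff]
    refine ⟨fun hw => ?_, fun hw => hw ▸ hcS⟩
    rcases hmem w hw with h' | rfl
    · exact h'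
    · tauto
  · push Not at hz1
    by_cases heq : O.nu c = O.nu z
    · obtain ⟨hfz, hez⟩ := H.fixed_of_large hP O h (c := z) (heq ▸ hc)
      exact hP ⟨c, z, hz1.1.symm, hec, hez, Or.inl hfc, Or.inr hfz⟩
    · refine hO.2 ⟨c, z, hz1.1.symm, ?_, heq⟩
      ext w
      simp only [Set.mem_ofPred_eq, Set.mem_insert_iff, Set.mem_singleton_iff]
      refine ⟨hmem w, ?_⟩
      rintro (rfl | rfl)
      exacts [hcS, hz1.2]

end BranchData

/-- The least common multiple of two orbifolds. -/
def Orbifold.lcm (O₁ O₂ : Orbifold) : Orbifold where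
  nu z := Nat.lcm (O₁.nu z) (O₂.nu z)
  one_le z := Nat.lcm_pos (O₁.one_le z) (O₂.one_le z)
  finite := (O₁.finite.union O₂.finite).subset fun z hz => by
    by_contra hcon
    simp only [Set.mem_union, Set.mem_ofPred_eq, not_or, not_not] at hcon hz
    rw [hcon.1, hcon.2] at hz
    exact hz rfl

/-- The trivial orbifold. -/
def Orbifold.triv : Orbifold where
  nu _ := 1
  one_le _ := le_rfl
  finite := by simp

/-- The support of an orbifold, as a finite set. -/
def Orbifold.supp (O : Orbifold) : Finset (OnePoint ℂ) := O.finite.toFinset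

lemma Orbifold.mem_supp {O : Orbifold} {z : OnePoint ℂ} : z ∈ O.supp ↔ O.nu z ≠ 1 := by
  simp [Orbifold.supp]

lemma Orbifold.good_iff (O : Orbifold) : O.Good ↔
    (∀ z, O.supp ≠ {z}) ∧ (∀ z₁ z₂, z₁ ≠ z₂ → O.supp = {z₁, z₂} → O.nu z₁ = O.nu z₂) := by
  have h1 : ∀ z, ({w : OnePoint ℂ | O.nu w ≠ 1} = {z}) ↔ O.supp = {z} := by
    intro z
    simp [Set.ext_iff, Finset.ext_iff, Orbifold.mem_supp]
  have h2 : ∀ z₁ z₂, ({w : OnePoint ℂ | O.nu w ≠ 1} = {z₁, z₂}) ↔ O.supp = {z₁, z₂} := by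
    intro z₁ z₂
    simp [Set.ext_iff, Finset.ext_iff, Orbifold.mem_supp]
  unfold Orbifold.Good
  simp only [h1, h2]
  push Not
  rfl

lemma Orbifold.Prec.supp_subset {O₁ O₂ : Orbifold} (h : O₁.Prec O₂) : O₁.supp ⊆ O₂.supp := by
  intro z
  rw [Orbifold.mem_supp, Orbifold.mem_supp]
  intro h1 h2
  exact h1 (Nat.dvd_one.1 (h2 ▸ h z))

lemma Orbifold.Prec.lcm_left (O₁ O₂ : Orbifold) : O₁.Prec (O₁.lcm O₂) := fun _ =>
  Nat.dvd_lcm_left _ _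

lemma Orbifold.Prec.lcm_right (O₁ O₂ : Orbifold) : O₂.Prec (O₁.lcm O₂) := fun _ =>
  Nat.dvd_lcm_right _ _

lemma Orbifold.Good.two_le_card {O : Orbifold} (hO : O.Good) (h : O.supp ≠ ∅) :
    2 ≤ O.supp.card := by
  have h1 : O.supp.card ≠ 0 := by simpa using h
  have h2 : O.supp.card ≠ 1 := by
    intro h2
    obtain ⟨z, hz⟩ := Finset.card_eq_one.1 h2
    exact (O.good_iff.1 hO).1 z hz
  omega

lemma Orbifold.Good.lcm {O₁ O₂ : Orbifold} (h₁ : O₁.Good) (h₂ : O₂.Good) :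
    (O₁.lcm O₂).Good := by
  have s1 := (Orbifold.Prec.lcm_left O₁ O₂).supp_subset
  have s2 := (Orbifold.Prec.lcm_right O₁ O₂).supp_subset
  rw [Orbifold.good_iff]
  have triv : ∀ O : Orbifold, O.supp = ∅ → ∀ z, O.nu z = 1 := by
    intro O hO z
    by_contra h
    have := Orbifold.mem_supp.2 h
    simp [hO] at this
  have key : ∀ O : Orbifold, O.Good → ∀ z₁ z₂, z₁ ≠ z₂ → O.supp ⊆ {z₁, z₂} →
      O.nu z₁ = O.nu z₂ := by
    intro O hO z₁ z₂ hne hsub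
    by_cases h : O.supp = ∅
    · rw [triv O h, triv O h]
    · exact (O.good_iff.1 hO).2 z₁ z₂ hne (Finset.eq_of_subset_of_card_le hsub
        (by rw [Finset.card_pair hne]; exact hO.two_le_card h))
  refine ⟨fun z hz => ?_, fun z₁ z₂ hne hz => ?_⟩
  · have single : ∀ O : Orbifold, O.Good → O.supp ⊆ {z} → ∀ z, O.nu z = 1 := by
      intro O hO hsub
      apply triv
      by_contra h
      have h1 := hO.two_le_card h
      have h2 := Finset.card_le_card hsub
      rw [Finset.card_singleton] at h2
      omega
    have hmem : z ∈ (O₁.lcm O₂).supp := by rw [hz]; simp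
    rw [Orbifold.mem_supp] at hmem
    apply hmem
    simp only [Orbifold.lcm]
    rw [single O₁ h₁ (hz ▸ s1), single O₂ h₂ (hz ▸ s2)]
    rfl
  · simp only [Orbifold.lcm]
    rw [key O₁ h₁ z₁ z₂ hne (hz ▸ s1), key O₂ h₂ z₁ z₂ hne (hz ▸ s2)]

lemma Orbifold.sum_lt_sum_lcm {O O' : Orbifold} (h : ¬ O'.Prec O) :
    ∑ z ∈ O.supp, (O.nu z - 1) < ∑ z ∈ (O.lcm O').supp, ((O.lcm O').nu z - 1) := by
  have hsub := (Orbifold.Prec.lcm_left O O').supp_subset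
  rw [Finset.sum_subset hsub (fun z _ hz => by
    rw [Orbifold.mem_supp, not_not] at hz
    simp [hz])]
  unfold Orbifold.Prec at h
  push Not at h
  obtain ⟨z, hz⟩ := h
  have hle : ∀ w, O.nu w ≤ (O.lcm O').nu w := fun w =>
    Nat.le_of_dvd ((O.lcm O').one_le w) (Orbifold.Prec.lcm_left O O' w)
  have hlt : O.nu z < (O.lcm O').nu z := by
    refine lt_of_le_of_ne (hle z) fun heq => hz ?_
    rw [heq]
    exact Orbifold.Prec.lcm_right O O' z
  have h1 := O.one_le z
  refine Finset.sum_lt_sum (fun w _ => Nat.sub_le_sub_right (hle w) 1) ⟨z, ?_, by omega⟩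
  rw [Orbifold.mem_supp]
  omega

namespace BranchData

variable {f : OnePoint ℂ → OnePoint ℂ} {e : OnePoint ℂ → ℕ} {d : ℕ}

/-- There is a maximal invariant orbifold. -/
lemma exists_maximal (H : BranchData f e d) (hP : ¬ PowerConfig f e d)
    (hC : ¬ ChebyConfig f e d) :
    ∃ O₀ : Orbifold, O₀.Good ∧ MinFun f e O₀.nu O₀.nu ∧
      ∀ O : Orbifold, O.Good → MinFun f e O.nu O.nu → O.Prec O₀ := by
  set m : Orbifold → ℕ := fun O => ∑ z ∈ O.supp, (O.nu z - 1) with hm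
  set P : ℕ → Prop := fun k => ∃ O : Orbifold, O.Good ∧ MinFun f e O.nu O.nu ∧ m O = k with hPdef
  have hbound : ∀ k, P k → k ≤ 4 * d ^ 4 := by
    rintro k ⟨O, hO, hmin, rfl⟩
    calc m O ≤ O.supp.card * d ^ 4 := by
          simpa using Finset.sum_le_card_nsmul O.supp (fun z => O.nu z - 1) (d ^ 4) fun z _ =>
            (Nat.sub_le _ _).trans (H.nu_le_of_good hP hC O hO hmin z)
      _ ≤ 4 * d ^ 4 := Nat.mul_le_mul_right _ (H.card_support_le O hmin)
  have hex : P (m Orbifold.triv) := by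
    refine ⟨Orbifold.triv, ?_, fun z => by simp [Orbifold.triv], rfl⟩
    rw [Orbifold.good_iff]
    have : Orbifold.triv.supp = ∅ := by
      ext z
      simp [Orbifold.mem_supp, Orbifold.triv]
    refine ⟨fun z hz => ?_, fun _ _ _ _ => rfl⟩
    rw [this] at hz
    exact (Finset.singleton_ne_empty z) hz.symm
  obtain ⟨O₀, hO₀, hmin₀, hm₀⟩ := Nat.findGreatest_spec (hbound _ hex) hex
  refine ⟨O₀, hO₀, hmin₀, fun O hO hmin => ?_⟩
  by_contra hnot
  have hlt := Orbifold.sum_lt_sum_lcm hnot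
  have hPl : P (m (O₀.lcm O)) := ⟨_, hO₀.lcm hO, hmin₀.lcm hmin, rfl⟩
  have := Nat.le_findGreatest (hbound _ hPl) hPl
  simp only [hm] at *
  omega

/-- The pull-back of a ramification function. -/
def pull (f : OnePoint ℂ → OnePoint ℂ) (e ν : OnePoint ℂ → ℕ) : OnePoint ℂ → ℕ :=
  fun z => Nat.lcm (ν (f z)) (e z) / e z

lemma minFun_pull (f : OnePoint ℂ → OnePoint ℂ) (e ν : OnePoint ℂ → ℕ) :
    MinFun f e (pull f e ν) ν := fun _ => Nat.div_mul_cancel (Nat.dvd_lcm_right _ _)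

/-- The pull-back of an orbifold. -/
def pullOrb (H : BranchData f e d) (O : Orbifold) : Orbifold where
  nu := pull f e O.nu
  one_le z := Nat.div_pos (Nat.le_of_dvd (Nat.lcm_pos (O.one_le _) (H.one_le z))
    (Nat.dvd_lcm_right _ _)) (H.one_le z)
  finite := by
    obtain ⟨T, hT, -⟩ := H.preimage O.supp
    refine T.finite_toSet.subset fun z hz => ?_
    rw [Finset.mem_coe, hT, Orbifold.mem_supp]
    intro h1
    exact hz (Nat.dvd_one.1 (h1 ▸ H.nu_dvd (minFun_pull f e O.nu) z))

lemma minFun_pullOrb (H : BranchData f e d) (O : Orbifold) :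
    MinFun f e (H.pullOrb O).nu O.nu := minFun_pull f e O.nu

/-- The least common multiple of the first `l` iterated pull-backs of an orbifold. -/
def lcmPull (H : BranchData f e d) (O : Orbifold) : ℕ → Orbifold
  | 0 => Orbifold.triv
  | l + 1 => (lcmPull H O l).lcm (H.pullOrb^[l] O)

/-- The product of local degrees along an orbit. -/
def iterDeg (f : OnePoint ℂ → OnePoint ℂ) (e : OnePoint ℂ → ℕ) : ℕ → OnePoint ℂ → ℕ
  | 0 => fun _ => 1
  | l + 1 => fun z => e (f^[l] z) * iterDeg f e l z

lemma lcmPull_dvd_iff (H : BranchData f e d) (O : Orbifold) (l : ℕ) (z : OnePoint ℂ) (m : ℕ) :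
    (H.lcmPull O l).nu z ∣ m ↔ ∀ j < l, (H.pullOrb^[j] O).nu z ∣ m := by
  induction l with
  | zero => simp [lcmPull, Orbifold.triv]
  | succ l ih =>
    simp only [lcmPull, Orbifold.lcm, Nat.lcm_dvd_iff, ih, Nat.forall_lt_succ_right]

lemma minFun_lcmPull (H : BranchData f e d) (O : Orbifold) (l : ℕ) :
    MinFun f e (H.lcmPull (H.pullOrb O) l).nu (H.lcmPull O l).nu := by
  induction l with
  | zero => intro z; simp [lcmPull, Orbifold.triv]
  | succ l ih =>
    refine ih.lcm ?_
    rw [← Function.iterate_succ_apply, Function.iterate_succ_apply']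
    exact H.minFun_pullOrb _

lemma minFun_iterate_pullOrb (H : BranchData f e d) (O : Orbifold) (l : ℕ) :
    MinFun f^[l] (iterDeg f e l) (H.pullOrb^[l] O).nu O.nu := by
  induction l generalizing O with
  | zero => intro z; simp [iterDeg]
  | succ l ih =>
    have := (H.minFun_pullOrb O).comp (ih (H.pullOrb O))
    intro z
    rw [Function.iterate_succ_apply' f, Function.iterate_succ_apply]
    exact this z

lemma minFun_iterate {O : Orbifold} (h : MinFun f e O.nu O.nu) (l : ℕ) :
    MinFun f^[l] (iterDeg f e l) O.nu O.nu := by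
  induction l with
  | zero => intro z; simp [iterDeg]
  | succ l ih =>
    intro z
    rw [Function.iterate_succ_apply' f]
    exact h.comp ih z

lemma one_le_iterDeg (H : BranchData f e d) (l : ℕ) (z : OnePoint ℂ) : 1 ≤ iterDeg f e l z := by
  induction l with
  | zero => exact le_rfl
  | succ l ih => exact Nat.mul_pos (H.one_le _) ih

lemma minFun_lcmPull_self (H : BranchData f e d) {O : Orbifold} {l : ℕ} (hl : 1 ≤ l)
    (h : MinFun f^[l] (iterDeg f e l) O.nu O.nu) :
    MinFun f e (H.lcmPull O l).nu (H.lcmPull O l).nu := by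
  have hper : ∀ z, (H.pullOrb^[l] O).nu z = O.nu z := fun z =>
    Nat.eq_of_mul_eq_mul_right (H.one_le_iterDeg l z)
      ((H.minFun_iterate_pullOrb O l z).trans (h z).symm)
  have heq : (H.lcmPull (H.pullOrb O) l).nu = (H.lcmPull O l).nu := by
    ext z
    have hmem := fun O => (H.lcmPull_dvd_iff O l z _).1 dvd_rfl
    apply Nat.dvd_antisymm
    · rw [lcmPull_dvd_iff]
      intro j hj
      rw [← Function.iterate_succ_apply]
      rcases Nat.lt_or_ge (j + 1) l with hj' | hj'
      · exact hmem O _ hj'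
      · rw [show j.succ = l by omega, hper]
        exact hmem O 0 hl
    · rw [lcmPull_dvd_iff]
      intro j hj
      rcases j with _ | j
      · have := hmem (H.pullOrb O) (l - 1) (by omega)
        rw [← Function.iterate_succ_apply, show (l - 1).succ = l by omega, hper] at this
        exact this
      · have := hmem (H.pullOrb O) j (by omega)
        rwa [← Function.iterate_succ_apply] at this
  have := H.minFun_lcmPull O l
  rwa [heq] at this

lemma coprime_of_fixed (H : BranchData f e d) {O : Orbifold} (h : MinFun f e O.nu O.nu)
    {a : OnePoint ℂ} (ha : f a = a) : Nat.Coprime (O.nu a) (e a) := by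
  have h1 := h a
  rw [ha] at h1
  have h2 := Nat.gcd_mul_lcm (O.nu a) (e a)
  rw [← h1] at h2
  exact Nat.eq_of_mul_eq_mul_right (Nat.mul_pos (O.one_le a) (H.one_le a))
    (h2.trans (one_mul _).symm)

lemma coprime_of_collapse (H : BranchData f e d) {L : Orbifold} (h : MinFun f e L.nu L.nu)
    {a b : OnePoint ℂ} (hab : a ≠ b) (hL : L.supp = {a, b}) (ha : f a = a) (hb : f b = a)
    {k : ℕ} (hka : k ∣ L.nu a) (hkb : k ∣ L.nu b) : Nat.Coprime k (e b) := by
  have hca := H.coprime_of_fixed h ha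
  have hone : ∀ z, z ≠ a → z ≠ b → L.nu z = 1 := by
    intro z h1 h2
    by_contra h3
    rw [← ne_eq, ← Orbifold.mem_supp, hL] at h3
    simp [h1, h2] at h3
  by_contra hcon
  obtain ⟨p, hp, hpk, hpb⟩ := Nat.Prime.not_coprime_iff_dvd.1 hcon
  have hpd : p ∣ d := by
    obtain ⟨F, hF, hs⟩ := H.fiber b
    rw [← hs]
    refine Finset.dvd_sum fun z hz => ?_
    rw [hF] at hz
    have h1 := dvd_deg h (hone z (by rintro rfl; exact hab (ha.symm.trans hz))
      (by rintro rfl; exact hab (hb.symm.trans hz)))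
    rw [hz] at h1
    exact (hpk.trans hkb).trans h1
  obtain ⟨F, hF, hs⟩ := H.fiber a
  have haF : a ∈ F := (hF a).2 ha
  rw [← Finset.add_sum_erase F e haF] at hs
  have hrest : p ∣ ∑ z ∈ F.erase a, e z := by
    refine Finset.dvd_sum fun z hz => ?_
    rw [Finset.mem_erase, hF] at hz
    by_cases hzb : z = b
    · rwa [hzb]
    · have h1 := dvd_deg h (hone z hz.1 hzb)
      rw [hz.2] at h1
      exact (hpk.trans hka).trans h1
  have hpa : p ∣ e a := (Nat.dvd_add_left hrest).1 (hs ▸ hpd)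
  exact Nat.Prime.not_coprime_iff_dvd.2 ⟨p, hp, hpk.trans hka, hpa⟩ hca

/-- A good orbifold supported on the two points of an invariant bad orbifold that dominates it
together with its pull-back is itself invariant. -/
lemma minFun_of_two_point (H : BranchData f e d) {L O : Orbifold} (h : MinFun f e L.nu L.nu)
    {a b : OnePoint ℂ} (hab : a ≠ b) (hL : L.supp = {a, b}) (hne : L.nu a ≠ L.nu b)
    (hO : O.nu a = O.nu b) (hOL : O.Prec L) (hpL : (H.pullOrb O).Prec L) :
    MinFun f e O.nu O.nu := by
  have hinv : ∀ z, z = a ∨ z = b → f z = a ∨ f z = b := by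
    intro z hz
    have h1 : z ∈ L.supp := by rw [hL]; simpa using hz
    have h2 : f z ∈ L.supp := by
      rw [Orbifold.mem_supp] at *
      intro h3
      exact h1 (Nat.dvd_one.1 (h3 ▸ H.nu_dvd h z))
    rw [hL] at h2
    simpa using h2
  have hL' : L.supp = {b, a} := by rw [hL, Finset.pair_comm]
  have hcop : Nat.Coprime (O.nu a) (e a) ∧ Nat.Coprime (O.nu a) (e b) := by
    have hkb : O.nu a ∣ L.nu b := hO ▸ hOL b
    rcases hinv a (Or.inl rfl) with ha | ha <;> rcases hinv b (Or.inr rfl) with hb | hb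
    · exact ⟨(H.coprime_of_fixed h ha).coprime_dvd_left (hOL a),
        H.coprime_of_collapse h hab hL ha hb (hOL a) hkb⟩
    · exact ⟨(H.coprime_of_fixed h ha).coprime_dvd_left (hOL a),
        (H.coprime_of_fixed h hb).coprime_dvd_left hkb⟩
    · exact absurd (Nat.dvd_antisymm (ha ▸ H.nu_dvd h a) (hb ▸ H.nu_dvd h b)) hne
    · exact ⟨H.coprime_of_collapse h hab.symm hL' hb ha hkb (hOL a),
        (H.coprime_of_fixed h hb).coprime_dvd_left hkb⟩
  have hval : ∀ z, z = a ∨ z = b → O.nu z = O.nu a := by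
    rintro z (rfl | rfl)
    exacts [rfl, hO.symm]
  intro z
  by_cases hz : z = a ∨ z = b
  · rw [hval z hz, hval _ (hinv z hz)]
    refine (Nat.Coprime.lcm_eq_mul ?_).symm
    rcases hz with rfl | rfl
    exacts [hcop.1, hcop.2]
  · have h1 : L.nu z = 1 := by
      by_contra h3
      rw [← ne_eq, ← Orbifold.mem_supp, hL] at h3
      simp [not_or.1 hz] at h3
    have h2 := Nat.dvd_one.1 (h1 ▸ hOL z)
    have h3 := Nat.dvd_one.1 (h1 ▸ hpL z)
    have := H.minFun_pullOrb O z
    rwa [h3, ← h2] at this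

/-- A good orbifold invariant under an iterate is dominated by a good invariant orbifold. -/
lemma exists_good_of_iterate (H : BranchData f e d) {O : Orbifold} (hO : O.Good) {l : ℕ}
    (hl : 1 ≤ l) (h : MinFun f^[l] (iterDeg f e l) O.nu O.nu) :
    ∃ O' : Orbifold, O'.Good ∧ MinFun f e O'.nu O'.nu ∧ O.Prec O' := by
  have hL := H.minFun_lcmPull_self hl h
  set L := H.lcmPull O l with hLdef
  have hpow : ∀ j < l, (H.pullOrb^[j] O).Prec L := fun j hj z =>
    (H.lcmPull_dvd_iff O l z _).1 dvd_rfl j hj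
  have hOL : O.Prec L := hpow 0 hl
  by_cases hgood : L.Good
  · exact ⟨L, hgood, hL, hOL⟩
  by_cases hempty : O.supp = ∅
  · have h1 : ∀ z, O.nu z = 1 := by
      intro z
      by_contra h
      have := Orbifold.mem_supp.2 h
      simp [hempty] at this
    exact ⟨O, hO, fun z => by simp [h1], fun z => dvd_rfl⟩
  have hcard := (hO.two_le_card hempty).trans (Finset.card_le_card hOL.supp_subset)
  rw [Orbifold.good_iff, not_and_or] at hgood
  rcases hgood with hgood | hgood
  · push Not at hgood
    obtain ⟨z, hz⟩ := hgood
    rw [hz, Finset.card_singleton] at hcard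
    omega
  push Not at hgood
  obtain ⟨a, b, hab, hLs, hne⟩ := hgood
  have hOs : O.supp = {a, b} := Finset.eq_of_subset_of_card_le (hLs ▸ hOL.supp_subset)
    (by rw [Finset.card_pair hab]; exact hO.two_le_card hempty)
  have hOab := (O.good_iff.1 hO).2 a b hab hOs
  refine ⟨O, hO, ?_, fun z => dvd_rfl⟩
  rcases Nat.lt_or_ge 1 l with hl1 | hl1
  · exact H.minFun_of_two_point hL hab hLs hne hOab hOL (hpow 1 hl1)
  · obtain rfl : l = 1 := by omega
    intro z
    simpa [iterDeg] using h z

end BranchData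

/-- A rational function that is not constant. -/
def NonConst (f : RatFunc ℂ) : Prop := ¬ ∃ c, f = RatFunc.C c

/-- Precomposition with a nonconstant rational function, as an algebra homomorphism. -/
def compHom (g : RatFunc ℂ) (hg : NonConst g) : RatFunc ℂ →ₐ[ℂ] RatFunc ℂ :=
  RatFunc.liftAlgHom (Polynomial.aeval g) (nonZeroDivisors_le_comap_nonZeroDivisors_of_injective _
    (transcendental_iff_injective.1 (g.transcendental_of_ne_C hg)))

lemma rcomp_eq (f : RatFunc ℂ) {g : RatFunc ℂ} (hg : NonConst g) :
    rcomp f g = compHom g hg f := (RatFunc.liftAlgHom_apply _ _ _).symm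

lemma compHom_C {g : RatFunc ℂ} (hg : NonConst g) (c : ℂ) :
    compHom g hg (RatFunc.C c) = RatFunc.C c := by
  rw [← RatFunc.algebraMap_eq_C]
  exact (compHom g hg).commutes c

lemma rcomp_algebraMap (p : ℂ[X]) {g : RatFunc ℂ} :
    rcomp (algebraMap ℂ[X] (RatFunc ℂ) p) g = Polynomial.aeval g p := by
  simp [rcomp]

lemma rcomp_X (g : RatFunc ℂ) : rcomp RatFunc.X g = g := by
  simp [rcomp]

lemma compHom_X {g : RatFunc ℂ} (hg : NonConst g) : compHom g hg RatFunc.X = g := by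
  rw [← rcomp_eq, rcomp_X]

lemma compHom_algebraMap {g : RatFunc ℂ} (hg : NonConst g) (p : ℂ[X]) :
    compHom g hg (algebraMap ℂ[X] (RatFunc ℂ) p) = Polynomial.aeval g p := by
  rw [← rcomp_eq, rcomp_algebraMap]

lemma rcomp_X_right (f : RatFunc ℂ) : rcomp f RatFunc.X = f := by
  simp only [rcomp, RatFunc.aeval_X_left_eq_algebraMap]
  exact RatFunc.num_div_denom f

lemma NonConst.rcomp {f g : RatFunc ℂ} (hf : NonConst f) (hg : NonConst g) :
    NonConst (rcomp f g) := by
  rintro ⟨c, hc⟩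
  rw [rcomp_eq f hg, ← compHom_C hg] at hc
  exact hf ⟨c, (compHom g hg).toRingHom.injective hc⟩

lemma rcomp_assoc (f : RatFunc ℂ) {g h : RatFunc ℂ} (hh : NonConst h) :
    rcomp (rcomp f g) h = rcomp f (rcomp g h) := by
  rw [rcomp_eq _ hh, rcomp_eq g hh, rcomp, rcomp, map_div₀, Polynomial.aeval_algHom_apply,
    Polynomial.aeval_algHom_apply]

lemma nonConst_X : NonConst RatFunc.X := by
  rintro ⟨c, hc⟩
  have := congrArg RatFunc.intDegree hc
  simp at this

lemma NonConst.ne_zero {f : RatFunc ℂ} (hf : NonConst f) : f ≠ 0 := by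
  rintro rfl
  exact hf ⟨0, by simp⟩

lemma NonConst.inv {f : RatFunc ℂ} (hf : NonConst f) : NonConst f⁻¹ := by
  rintro ⟨c, hc⟩
  exact hf ⟨c⁻¹, by rw [map_inv₀, ← hc, inv_inv]⟩

lemma flip_eq (f : RatFunc ℂ) : flip f = compHom _ nonConst_X.inv f := rcomp_eq _ _

lemma NonConst.flip {f : RatFunc ℂ} (hf : NonConst f) : NonConst (flip f) :=
  hf.rcomp nonConst_X.inv

/-- `f` is regular at `a` with value `v`. -/
def RegAt (a v : ℂ) (f : RatFunc ℂ) : Prop :=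
  ∃ P Q : ℂ[X], Q.eval a ≠ 0 ∧ P.eval a = v * Q.eval a ∧
    f = algebraMap ℂ[X] (RatFunc ℂ) P / algebraMap ℂ[X] (RatFunc ℂ) Q

lemma algebraMap_ne_zero_of_eval {Q : ℂ[X]} {a : ℂ} (h : Q.eval a ≠ 0) :
    algebraMap ℂ[X] (RatFunc ℂ) Q ≠ 0 := by
  rw [Ne, FaithfulSMul.algebraMap_eq_zero_iff]
  rintro rfl
  simp at h

lemma regAt_algebraMap (a : ℂ) (P : ℂ[X]) :
    RegAt a (P.eval a) (algebraMap ℂ[X] (RatFunc ℂ) P) :=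
  ⟨P, 1, by simp, by simp, by simp⟩

lemma regAt_C (a c : ℂ) : RegAt a c (RatFunc.C c) := by
  simpa using regAt_algebraMap a (Polynomial.C c)

lemma regAt_X_sub_C (a : ℂ) : RegAt a 0 (RatFunc.X - RatFunc.C a) := by
  have := regAt_algebraMap a (Polynomial.X - Polynomial.C a)
  rwa [map_sub, RatFunc.algebraMap_X, RatFunc.algebraMap_C, eval_sub, eval_X, eval_C,
    sub_self] at this

lemma RegAt.add {a v w : ℂ} {f g : RatFunc ℂ} (hf : RegAt a v f) (hg : RegAt a w g) :
    RegAt a (v + w) (f + g) := by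
  obtain ⟨P, Q, hQ, hP, rfl⟩ := hf
  obtain ⟨P', Q', hQ', hP', rfl⟩ := hg
  refine ⟨P * Q' + P' * Q, Q * Q', by simp [hQ, hQ'], by simp [hP, hP']; ring, ?_⟩
  have := algebraMap_ne_zero_of_eval hQ
  have := algebraMap_ne_zero_of_eval hQ'
  rw [map_add, map_mul, map_mul, map_mul]
  field_simp

lemma RegAt.mul {a v w : ℂ} {f g : RatFunc ℂ} (hf : RegAt a v f) (hg : RegAt a w g) :
    RegAt a (v * w) (f * g) := by
  obtain ⟨P, Q, hQ, hP, rfl⟩ := hf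
  obtain ⟨P', Q', hQ', hP', rfl⟩ := hg
  refine ⟨P * P', Q * Q', by simp [hQ, hQ'], by simp [hP, hP']; ring, ?_⟩
  rw [map_mul, map_mul, div_mul_div_comm]

lemma RegAt.pow {a v : ℂ} {f : RatFunc ℂ} (hf : RegAt a v f) (n : ℕ) :
    RegAt a (v ^ n) (f ^ n) := by
  induction n with
  | zero => simpa using regAt_C a 1
  | succ n ih => rw [pow_succ, pow_succ]; exact ih.mul hf

lemma RegAt.inv {a v : ℂ} {f : RatFunc ℂ} (hf : RegAt a v f) (hv : v ≠ 0) :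
    RegAt a v⁻¹ f⁻¹ := by
  obtain ⟨P, Q, hQ, hP, rfl⟩ := hf
  refine ⟨Q, P, by rw [hP]; exact mul_ne_zero hv hQ, by rw [hP]; field_simp, by rw [inv_div]⟩

lemma RegAt.unique {a v w : ℂ} {f : RatFunc ℂ} (hf : RegAt a v f) (hg : RegAt a w f) :
    v = w := by
  obtain ⟨P, Q, hQ, hP, rfl⟩ := hf
  obtain ⟨P', Q', hQ', hP', h⟩ := hg
  rw [div_eq_div_iff (algebraMap_ne_zero_of_eval hQ) (algebraMap_ne_zero_of_eval hQ'), ← map_mul,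
    ← map_mul] at h
  have := congrArg (Polynomial.eval a) (RatFunc.algebraMap_injective ℂ h)
  rw [eval_mul, eval_mul, hP, hP'] at this
  have h2 : (v - w) * (eval a Q * eval a Q') = 0 := by linear_combination this
  simpa [hQ, hQ', sub_eq_zero] using h2

lemma RegAt.aeval {a b : ℂ} {g : RatFunc ℂ} (hg : RegAt a b g) (P : ℂ[X]) :
    RegAt a (P.eval b) (Polynomial.aeval g P) := by
  induction P using Polynomial.induction_on' with
  | add p q hp hq => rw [eval_add, map_add]; exact hp.add hq
  | monomial n c =>
    rw [eval_monomial, Polynomial.aeval_monomial, RatFunc.algebraMap_eq_C]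
    exact (regAt_C a c).mul (hg.pow n)

/-- A local coordinate at `c` applied to `f`. -/
def coordAt (c : OnePoint ℂ) (f : RatFunc ℂ) : RatFunc ℂ :=
  OnePoint.rec f⁻¹ (fun c => f - RatFunc.C c) c

@[simp] lemma coordAt_infty (f : RatFunc ℂ) : coordAt ∞ f = f⁻¹ := rfl

@[simp] lemma coordAt_coe (c : ℂ) (f : RatFunc ℂ) : coordAt c f = f - RatFunc.C c := rfl

lemma compHom_coordAt {g : RatFunc ℂ} (hg : NonConst g) (c : OnePoint ℂ) (f : RatFunc ℂ) :
    compHom g hg (coordAt c f) = coordAt c (compHom g hg f) := by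
  induction c using OnePoint.rec with
  | infty => simp
  | coe c => simp [compHom_C]

/-- At the finite point `a`, `f` takes the value `c` with multiplicity `k`. -/
def LocF (f : RatFunc ℂ) (a : ℂ) (c : OnePoint ℂ) (k : ℕ) : Prop :=
  1 ≤ k ∧ ∃ v u, v ≠ 0 ∧ RegAt a v u ∧ coordAt c f = (RatFunc.X - RatFunc.C a) ^ k * u

/-- At `x`, `f` takes the value `c` with multiplicity `k`. -/
def Loc (f : RatFunc ℂ) (x c : OnePoint ℂ) (k : ℕ) : Prop :=
  OnePoint.rec (LocF (flip f) 0 c k) (fun a => LocF f a c k) x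

lemma X_sub_C_ne_zero' (a : ℂ) : (RatFunc.X - RatFunc.C a : RatFunc ℂ) ≠ 0 := by
  rw [sub_ne_zero]
  exact fun h => nonConst_X ⟨a, h⟩

lemma exists_eq_pow_mul {p : ℂ[X]} (hp : p ≠ 0) (a : ℂ) : ∃ q : ℂ[X], q.eval a ≠ 0 ∧
    algebraMap ℂ[X] (RatFunc ℂ) p =
      (RatFunc.X - RatFunc.C a) ^ rootMultiplicity a p * algebraMap ℂ[X] (RatFunc ℂ) q := by
  obtain ⟨q, hq, hnd⟩ := exists_eq_pow_rootMultiplicity_mul_and_not_dvd p hp a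
  refine ⟨q, by rwa [dvd_iff_isRoot] at hnd, ?_⟩
  nth_rw 1 [hq]
  simp

lemma num_eval_ne_zero {f : RatFunc ℂ} {a : ℂ} (h : f.denom.eval a = 0) : f.num.eval a ≠ 0 := by
  intro h'
  obtain ⟨u, v, huv⟩ := f.isCoprime_num_denom
  have := congrArg (eval a) huv
  simp [h, h'] at this

lemma denom_map_ne_zero (f : RatFunc ℂ) : algebraMap ℂ[X] (RatFunc ℂ) f.denom ≠ 0 := by
  rw [Ne, FaithfulSMul.algebraMap_eq_zero_iff]
  exact f.denom_ne_zero

lemma sub_C_eq (f : RatFunc ℂ) (c : ℂ) : f - RatFunc.C c =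
    algebraMap ℂ[X] (RatFunc ℂ) (f.num - Polynomial.C c * f.denom) /
      algebraMap ℂ[X] (RatFunc ℂ) f.denom := by
  have h := denom_map_ne_zero f
  nth_rw 1 [← RatFunc.num_div_denom f]
  rw [map_sub, map_mul, RatFunc.algebraMap_C]
  field_simp

lemma NonConst.sub_ne_zero {f : RatFunc ℂ} (hf : NonConst f) (c : ℂ) :
    f.num - Polynomial.C c * f.denom ≠ 0 := by
  intro h
  have := sub_C_eq f c
  rw [h, map_zero, zero_div, _root_.sub_eq_zero] at this
  exact hf ⟨c, this⟩

lemma NonConst.locF {f : RatFunc ℂ} (hf : NonConst f) (a : ℂ) :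
    LocF f a (evalF f a) (locDegF f a) := by
  unfold evalF locDegF
  split_ifs with h
  · refine ⟨(rootMultiplicity_pos f.denom_ne_zero).2 h, ?_⟩
    obtain ⟨q, hq, hd⟩ := exists_eq_pow_mul f.denom_ne_zero a
    have hn := num_eval_ne_zero h
    refine ⟨_, _, mul_ne_zero hq (inv_ne_zero hn),
      (regAt_algebraMap a q).mul ((regAt_algebraMap a f.num).inv hn), ?_⟩
    rw [coordAt_infty]
    nth_rw 1 [← RatFunc.num_div_denom f]
    rw [inv_div, hd]
    ring
  · set c := f.num.eval a / f.denom.eval a with hc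
    have hne := hf.sub_ne_zero c
    refine ⟨(rootMultiplicity_pos hne).2 ?_, ?_⟩
    · simp [hc, h]
    obtain ⟨q, hq, hd⟩ := exists_eq_pow_mul hne a
    refine ⟨_, _, mul_ne_zero hq (inv_ne_zero h),
      (regAt_algebraMap a q).mul ((regAt_algebraMap a f.denom).inv h), ?_⟩
    rw [coordAt_coe, sub_C_eq, hd]
    ring

lemma LocF.regAt_coordAt {f : RatFunc ℂ} {a : ℂ} {c : OnePoint ℂ} {k : ℕ} (h : LocF f a c k) :
    RegAt a 0 (coordAt c f) := by
  obtain ⟨hk, v, u, -, hu, heq⟩ := h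
  rw [heq]
  have := ((regAt_X_sub_C a).pow k).mul hu
  rwa [zero_pow (by omega), zero_mul] at this

lemma LocF.regAt {f : RatFunc ℂ} {a c : ℂ} {k : ℕ} (h : LocF f a c k) : RegAt a c f := by
  have := h.regAt_coordAt.add (regAt_C a c)
  rwa [coordAt_coe, sub_add_cancel, zero_add] at this

lemma LocF.le_of_eq {f g : RatFunc ℂ} {a : ℂ} {c c' : OnePoint ℂ} {k l : ℕ} (h : LocF f a c k)
    (h' : LocF g a c' l) (heq : coordAt c f = coordAt c' g) : l ≤ k := by
  obtain ⟨hk, v, u, hv, hu, h1⟩ := h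
  obtain ⟨hl, v', u', hv', hu', h2⟩ := h'
  by_contra hlt
  push Not at hlt
  rw [heq, h2, show l = k + (l - k) by omega, pow_add, mul_assoc] at h1
  have h3 := mul_left_cancel₀ (pow_ne_zero _ (X_sub_C_ne_zero' a)) h1
  have h4 := ((regAt_X_sub_C a).pow (l - k)).mul hu'
  rw [h3, zero_pow (by omega), zero_mul] at h4
  exact hv (hu.unique h4)

lemma LocF.unique {f : RatFunc ℂ} (hf : NonConst f) {a : ℂ} {c c' : OnePoint ℂ} {k l : ℕ}
    (h : LocF f a c k) (h' : LocF f a c' l) : c = c' ∧ k = l := by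
  have key : ∀ (b : ℂ) (k l : ℕ), LocF f a b k → ¬ LocF f a ∞ l := by
    intro b k l h1 h2
    have := h1.regAt.mul h2.regAt_coordAt
    rw [coordAt_infty, mul_inv_cancel₀ hf.ne_zero, mul_zero] at this
    have h3 := regAt_C a 1
    rw [map_one] at h3
    exact zero_ne_one (this.unique h3)
  have hc : c = c' := by
    induction c using OnePoint.rec with
    | infty =>
      induction c' using OnePoint.rec with
      | infty => rfl
      | coe c' => exact absurd h (key _ _ _ h')
    | coe c =>
      induction c' using OnePoint.rec with
      | infty => exact absurd h' (key _ _ _ h)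
      | coe c' => rw [h.regAt.unique h'.regAt]
  subst hc
  exact ⟨rfl, le_antisymm (h'.le_of_eq h rfl) (h.le_of_eq h' rfl)⟩

lemma NonConst.loc {f : RatFunc ℂ} (hf : NonConst f) (x : OnePoint ℂ) :
    Loc f x (evalOP f x) (locDeg f x) := by
  induction x using OnePoint.rec with
  | infty => exact hf.flip.locF 0
  | coe a => exact hf.locF a

lemma Loc.eq {f : RatFunc ℂ} (hf : NonConst f) {x c : OnePoint ℂ} {k : ℕ} (h : Loc f x c k) :
    evalOP f x = c ∧ locDeg f x = k := by
  induction x using OnePoint.rec with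
  | infty => exact (hf.flip.locF 0).unique hf.flip h
  | coe a => exact (hf.locF a).unique hf h

lemma one_le_locDeg {f : RatFunc ℂ} (hf : NonConst f) (x : OnePoint ℂ) : 1 ≤ locDeg f x := by
  have := hf.loc x
  induction x using OnePoint.rec with
  | infty => exact this.1
  | coe a => exact this.1

lemma LocF.comp_coe {f g : RatFunc ℂ} (hg : NonConst g) {a b : ℂ}
    {z : OnePoint ℂ} {k m : ℕ} (h : LocF g a b k) (h' : LocF f b z m) :
    LocF (rcomp f g) a z (m * k) := by
  have hreg := h.regAt
  obtain ⟨hk, v, u, hv, hu, h1⟩ := h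
  obtain ⟨hm, w, t, hw, ⟨P, Q, hQ, hP, rfl⟩, h2⟩ := h'
  have hP0 : P.eval b ≠ 0 := by rw [hP]; exact mul_ne_zero hw hQ
  refine ⟨Nat.mul_pos hm hk, _, _, mul_ne_zero (pow_ne_zero m hv)
    (mul_ne_zero hP0 (inv_ne_zero hQ)),
    (hu.pow m).mul ((hreg.aeval P).mul ((hreg.aeval Q).inv hQ)), ?_⟩
  rw [coordAt_coe] at h1
  rw [rcomp_eq f hg, ← compHom_coordAt, h2, map_mul, map_pow, map_sub, compHom_X, compHom_C, h1,
    map_div₀, compHom_algebraMap, compHom_algebraMap, mul_pow, ← pow_mul, mul_comm k m]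
  ring

lemma rcomp_flip_inv (f : RatFunc ℂ) {g : RatFunc ℂ} (hg : NonConst g) :
    rcomp (flip f) g⁻¹ = rcomp f g := by
  rw [flip, rcomp_assoc _ hg.inv, rcomp_eq _ hg.inv, map_inv₀, compHom_X, inv_inv]

lemma LocF.comp {f g : RatFunc ℂ} (hg : NonConst g) {a : ℂ} {y z : OnePoint ℂ} {k m : ℕ}
    (h : LocF g a y k) (h' : Loc f y z m) : LocF (rcomp f g) a z (m * k) := by
  induction y using OnePoint.rec with
  | infty =>
    rw [← rcomp_flip_inv f hg]
    refine LocF.comp_coe hg.inv (b := 0) ?_ h'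
    simpa [LocF] using h
  | coe b => exact h.comp_coe hg h'

lemma Loc.comp {f g : RatFunc ℂ} (hg : NonConst g) {x y z : OnePoint ℂ} {k m : ℕ}
    (h : Loc g x y k) (h' : Loc f y z m) : Loc (rcomp f g) x z (m * k) := by
  induction x using OnePoint.rec with
  | infty =>
    change LocF (GenLattes.flip (rcomp f g)) 0 z (m * k)
    rw [GenLattes.flip, rcomp_assoc _ nonConst_X.inv]
    exact LocF.comp hg.flip h h'
  | coe a => exact LocF.comp hg h h'

lemma evalOP_rcomp {f g : RatFunc ℂ} (hf : NonConst f) (hg : NonConst g) (x : OnePoint ℂ) :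
    evalOP (rcomp f g) x = evalOP f (evalOP g x) :=
  (((hg.loc x).comp hg (hf.loc _)).eq (hf.rcomp hg)).1

lemma locDeg_rcomp {f g : RatFunc ℂ} (hf : NonConst f) (hg : NonConst g) (x : OnePoint ℂ) :
    locDeg (rcomp f g) x = locDeg f (evalOP g x) * locDeg g x :=
  (((hg.loc x).comp hg (hf.loc _)).eq (hf.rcomp hg)).2

lemma loc_X (x : OnePoint ℂ) : Loc RatFunc.X x x 1 := by
  have h1 : ∀ a : ℂ, RegAt a 1 1 := fun a => by simpa using regAt_C a 1
  induction x using OnePoint.rec with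
  | infty =>
    refine ⟨le_rfl, 1, 1, one_ne_zero, h1 0, ?_⟩
    rw [flip, rcomp_X]
    simp
  | coe a => exact ⟨le_rfl, 1, 1, one_ne_zero, h1 a, by simp⟩

lemma NonConst.riter {A : RatFunc ℂ} (hA : NonConst A) (l : ℕ) : NonConst (riter A l) := by
  induction l with
  | zero => exact nonConst_X
  | succ l ih => exact hA.rcomp ih

lemma evalOP_riter {A : RatFunc ℂ} (hA : NonConst A) (l : ℕ) :
    evalOP (riter A l) = (evalOP A)^[l] := by
  ext x
  induction l with
  | zero => exact ((loc_X x).eq nonConst_X).1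
  | succ l ih =>
    rw [Function.iterate_succ_apply', ← ih]
    exact evalOP_rcomp hA (hA.riter l) x

lemma locDeg_riter {A : RatFunc ℂ} (hA : NonConst A) (l : ℕ) :
    locDeg (riter A l) = BranchData.iterDeg (evalOP A) (locDeg A) l := by
  ext x
  induction l with
  | zero => exact ((loc_X x).eq nonConst_X).2
  | succ l ih =>
    change _ = locDeg A ((evalOP A)^[l] x) * BranchData.iterDeg (evalOP A) (locDeg A) l x
    rw [← ih, ← evalOP_riter hA]
    exact locDeg_rcomp hA (hA.riter l) x

/-- The polynomial whose finite roots form the finite part of the fiber of `f` over `c`. -/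
def fibPoly (f : RatFunc ℂ) (c : OnePoint ℂ) : ℂ[X] :=
  OnePoint.rec f.denom (fun c => f.num - Polynomial.C c * f.denom) c

/-- A polynomial without common roots with `fibPoly f c`. -/
def cofibPoly (f : RatFunc ℂ) (c : OnePoint ℂ) : ℂ[X] :=
  OnePoint.rec f.num (fun _ => f.denom) c

@[simp] lemma fibPoly_infty (f : RatFunc ℂ) : fibPoly f ∞ = f.denom := rfl

@[simp] lemma fibPoly_coe (f : RatFunc ℂ) (c : ℂ) :
    fibPoly f c = f.num - Polynomial.C c * f.denom := rfl

@[simp] lemma cofibPoly_infty (f : RatFunc ℂ) : cofibPoly f ∞ = f.num := rfl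

@[simp] lemma cofibPoly_coe (f : RatFunc ℂ) (c : ℂ) : cofibPoly f c = f.denom := rfl

lemma coordAt_eq_fibPoly_div (f : RatFunc ℂ) (c : OnePoint ℂ) :
    coordAt c f = algebraMap ℂ[X] (RatFunc ℂ) (fibPoly f c) /
      algebraMap ℂ[X] (RatFunc ℂ) (cofibPoly f c) := by
  induction c using OnePoint.rec with
  | infty =>
    simp only [coordAt_infty, fibPoly_infty, cofibPoly_infty]
    nth_rw 1 [← RatFunc.num_div_denom f]
    rw [inv_div]
  | coe c => simpa using sub_C_eq f c

lemma NonConst.fibPoly_ne_zero {f : RatFunc ℂ} (hf : NonConst f) (c : OnePoint ℂ) :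
    fibPoly f c ≠ 0 := by
  induction c using OnePoint.rec with
  | infty => exact f.denom_ne_zero
  | coe c => exact hf.sub_ne_zero c

lemma NonConst.cofibPoly_ne_zero {f : RatFunc ℂ} (hf : NonConst f) (c : OnePoint ℂ) :
    cofibPoly f c ≠ 0 := by
  induction c using OnePoint.rec with
  | infty => exact RatFunc.num_ne_zero hf.ne_zero
  | coe c => exact f.denom_ne_zero

lemma evalF_eq_iff (f : RatFunc ℂ) (a : ℂ) (c : OnePoint ℂ) :
    evalF f a = c ↔ (fibPoly f c).eval a = 0 := by
  unfold evalF
  induction c using OnePoint.rec with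
  | infty => split_ifs with h <;> simp [h]
  | coe c =>
    split_ifs with h
    · simp [h, num_eval_ne_zero h]
    · simp [h, div_eq_iff, sub_eq_zero]

lemma locDegF_eq (f : RatFunc ℂ) (a : ℂ) :
    locDegF f a = rootMultiplicity a (fibPoly f (evalF f a)) := by
  unfold evalF locDegF
  split_ifs with h <;> rfl

lemma natDegree_fibPoly_le (f : RatFunc ℂ) (c : OnePoint ℂ) :
    (fibPoly f c).natDegree ≤ rdeg f := by
  induction c using OnePoint.rec with
  | infty => exact le_max_right _ _
  | coe c =>
    exact (natDegree_sub_le _ _).trans (max_le_max le_rfl (natDegree_C_mul_le _ _))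

lemma natDegree_cofibPoly_le (f : RatFunc ℂ) (c : OnePoint ℂ) :
    (cofibPoly f c).natDegree ≤ rdeg f := by
  induction c using OnePoint.rec with
  | infty => exact le_max_left _ _
  | coe c => exact le_max_right _ _

lemma natDegree_cofibPoly {f : RatFunc ℂ} {c : OnePoint ℂ}
    (h : (fibPoly f c).natDegree < rdeg f) : (cofibPoly f c).natDegree = rdeg f := by
  induction c using OnePoint.rec with
  | infty =>
    simp only [fibPoly_infty, cofibPoly_infty, rdeg] at *
    omega
  | coe c =>
    simp only [fibPoly_coe, cofibPoly_coe] at *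
    refine le_antisymm (le_max_right _ _) ?_
    by_contra! hlt
    have h1 : f.num.natDegree = rdeg f := by simp only [rdeg] at *; omega
    have h2 : (Polynomial.C c * f.denom).natDegree < f.num.natDegree :=
      (natDegree_C_mul_le _ _).trans_lt (h1 ▸ hlt)
    rw [natDegree_sub_eq_left_of_natDegree_lt h2] at h
    omega

lemma aeval_inv_X (p : ℂ[X]) : Polynomial.aeval (RatFunc.X : RatFunc ℂ)⁻¹ p =
    algebraMap ℂ[X] (RatFunc ℂ) p.reverse / RatFunc.X ^ p.natDegree := by
  have hX : (RatFunc.X : RatFunc ℂ) ≠ 0 := RatFunc.X_ne_zero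
  let _ : Invertible (RatFunc.X⁻¹ : RatFunc ℂ) := invertibleOfNonzero (inv_ne_zero hX)
  have := eval₂_reverse_mul_pow (algebraMap ℂ (RatFunc ℂ)) (RatFunc.X⁻¹) p
  rw [invOf_eq_inv, inv_inv] at this
  rw [Polynomial.aeval_def, ← this, ← Polynomial.aeval_def, RatFunc.aeval_X_left_eq_algebraMap,
    inv_pow, div_eq_mul_inv]

lemma loc_infty {f : RatFunc ℂ} (hf : NonConst f) {c : OnePoint ℂ}
    (h : (fibPoly f c).natDegree < rdeg f) : Loc f ∞ c (rdeg f - (fibPoly f c).natDegree) := by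
  have hR : (fibPoly f c).reverse.eval 0 ≠ 0 := by
    rw [← coeff_zero_eq_eval_zero, coeff_zero_reverse, leadingCoeff_ne_zero]
    exact hf.fibPoly_ne_zero c
  have hS : (cofibPoly f c).reverse.eval 0 ≠ 0 := by
    rw [← coeff_zero_eq_eval_zero, coeff_zero_reverse, leadingCoeff_ne_zero]
    exact hf.cofibPoly_ne_zero c
  refine ⟨by omega, _, _, mul_ne_zero hR (inv_ne_zero hS),
    (regAt_algebraMap 0 _).mul ((regAt_algebraMap 0 _).inv hS), ?_⟩
  have hX : (RatFunc.X : RatFunc ℂ) ≠ 0 := RatFunc.X_ne_zero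
  rw [flip_eq, ← compHom_coordAt, coordAt_eq_fibPoly_div, map_div₀, compHom_algebraMap,
    compHom_algebraMap, aeval_inv_X, aeval_inv_X, natDegree_cofibPoly h, map_zero, sub_zero,
    pow_sub₀ _ hX h.le]
  have := algebraMap_ne_zero_of_eval hS
  field_simp

lemma exists_natDegree_fibPoly_lt {f : RatFunc ℂ} (hd : 1 ≤ rdeg f) :
    ∃ c, (fibPoly f c).natDegree < rdeg f := by
  by_cases h : f.denom.natDegree < rdeg f
  · exact ⟨∞, h⟩
  have hQ : f.denom.natDegree = rdeg f := le_antisymm (le_max_right _ _) (not_lt.1 h)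
  refine ⟨((f.num.coeff (rdeg f) : ℂ) : OnePoint ℂ), ?_⟩
  refine lt_of_le_of_ne (natDegree_fibPoly_le _ _) fun h2 => ?_
  have h3 : (fibPoly f ((f.num.coeff (rdeg f) : ℂ) : OnePoint ℂ)).coeff (rdeg f) = 0 := by
    have : f.denom.coeff (rdeg f) = 1 := by
      rw [← hQ]
      exact f.monic_denom
    simp [this]
  nth_rw 2 [← h2] at h3
  rw [coeff_natDegree, leadingCoeff_eq_zero] at h3
  rw [h3, natDegree_zero] at h2
  omega

lemma nonConst_of_one_le {f : RatFunc ℂ} (hd : 1 ≤ rdeg f) : NonConst f := by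
  rintro ⟨c, rfl⟩
  simp [rdeg] at hd

lemma evalOP_infty {f : RatFunc ℂ} (hf : NonConst f) (hd : 1 ≤ rdeg f) (c : OnePoint ℂ) :
    (evalOP f ∞ = c ↔ (fibPoly f c).natDegree < rdeg f) ∧
      (evalOP f ∞ = c → locDeg f ∞ = rdeg f - (fibPoly f c).natDegree) := by
  obtain ⟨c', hc'⟩ := exists_natDegree_fibPoly_lt hd
  have h1 := (loc_infty hf hc').eq hf
  refine ⟨⟨?_, fun h => ((loc_infty hf h).eq hf).1⟩, ?_⟩
  · rw [h1.1]
    rintro rfl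
    exact hc'
  · rw [h1.1]
    rintro rfl
    exact h1.2

lemma NonConst.one_le_rdeg {f : RatFunc ℂ} (hf : NonConst f) : 1 ≤ rdeg f := by
  by_contra! h
  have h1 : f.num.natDegree = 0 := by unfold rdeg at h; omega
  have h2 : f.denom.natDegree = 0 := by unfold rdeg at h; omega
  rw [natDegree_eq_zero] at h1 h2
  obtain ⟨x, hx⟩ := h1
  obtain ⟨y, hy⟩ := h2
  refine hf ⟨x / y, ?_⟩
  rw [← RatFunc.num_div_denom f, ← hx, ← hy]
  simp

lemma exists_fiber {f : RatFunc ℂ} (hf : NonConst f) (c : OnePoint ℂ) :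
    ∃ F : Finset (OnePoint ℂ), (∀ z, z ∈ F ↔ evalOP f z = c) ∧
      ∑ z ∈ F, locDeg f z = rdeg f := by
  have hR := hf.fibPoly_ne_zero c
  have hinf := evalOP_infty hf hf.one_le_rdeg c
  have hle := natDegree_fibPoly_le f c
  set R := fibPoly f c with hRdef
  set F₀ : Finset (OnePoint ℂ) := R.roots.toFinset.map ⟨_, OnePoint.coe_injective⟩ with hF₀
  have hmem : ∀ a : ℂ, (a : OnePoint ℂ) ∈ F₀ ↔ evalOP f a = c := by
    intro a
    change _ ↔ evalF f a = c
    rw [evalF_eq_iff]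
    simp [hF₀, hR, ← hRdef]
  have hninf : ∞ ∉ F₀ := by simp [hF₀]
  have hsum : ∑ z ∈ F₀, locDeg f z = R.natDegree := by
    rw [hF₀, Finset.sum_map, ← splits_iff_card_roots.1 (IsAlgClosed.splits R),
      ← Multiset.toFinset_sum_count_eq]
    refine Finset.sum_congr rfl fun a ha => ?_
    rw [count_roots]
    change locDegF f a = _
    rw [locDegF_eq, (evalF_eq_iff f a c).2]
    exact (mem_roots'.1 (Multiset.mem_toFinset.1 ha)).2
  by_cases h : R.natDegree < rdeg f
  · refine ⟨insert ∞ F₀, fun z => ?_, ?_⟩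
    · induction z using OnePoint.rec with
      | infty => simp [hinf.1.2 h]
      | coe a => rw [← hmem]; simp
    · rw [Finset.sum_insert hninf, hsum, hinf.2 (hinf.1.2 h)]
      omega
  · refine ⟨F₀, fun z => ?_, by omega⟩
    induction z using OnePoint.rec with
    | infty => rw [hinf.1]; simp [hninf, h]
    | coe a => exact hmem a

lemma wronskian_fibPoly (f : RatFunc ℂ) (c : OnePoint ℂ) :
    wronskian (fibPoly f c) (cofibPoly f c) = wronskian f.num f.denom ∨
      wronskian (fibPoly f c) (cofibPoly f c) = -wronskian f.num f.denom := by
  induction c using OnePoint.rec with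
  | infty => right; simp [wronskian_neg_eq]
  | coe c =>
    left
    simp only [fibPoly_coe, cofibPoly_coe, wronskian, derivative_sub, derivative_mul,
      derivative_C]
    ring

lemma NonConst.wronskian_ne_zero {f : RatFunc ℂ} (hf : NonConst f) :
    wronskian f.num f.denom ≠ 0 := by
  rw [Ne, f.isCoprime_num_denom.wronskian_eq_zero_iff]
  rintro ⟨h1, h2⟩
  have h3 := derivative_eq_zero.1 h1
  have h4 := derivative_eq_zero.1 h2
  have := hf.one_le_rdeg
  simp [rdeg, h3, h4] at this

lemma dvd_wronskian_fibPoly_iff (f : RatFunc ℂ) (c : OnePoint ℂ) (p : ℂ[X]) :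
    p ∣ wronskian (fibPoly f c) (cofibPoly f c) ↔ p ∣ wronskian f.num f.denom := by
  rcases wronskian_fibPoly f c with h | h <;> simp [h]

lemma natDegree_wronskian_fibPoly (f : RatFunc ℂ) (c : OnePoint ℂ) :
    (wronskian (fibPoly f c) (cofibPoly f c)).natDegree =
      (wronskian f.num f.denom).natDegree := by
  rcases wronskian_fibPoly f c with h | h <;> simp [h]

lemma locDegF_sub_one_le {f : RatFunc ℂ} (hf : NonConst f) (a : ℂ) :
    locDegF f a - 1 ≤ rootMultiplicity a (wronskian f.num f.denom) := by
  rw [le_rootMultiplicity_iff hf.wronskian_ne_zero,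
    ← dvd_wronskian_fibPoly_iff f (evalF f a), locDegF_eq]
  have h := pow_rootMultiplicity_dvd (fibPoly f (evalF f a)) a
  exact dvd_sub (((pow_dvd_pow _ (Nat.sub_le _ _)).trans h).mul_right _)
    ((pow_sub_one_dvd_derivative_of_pow_dvd h).mul_right _)

lemma sum_locDegF_sub_one_le {f : RatFunc ℂ} (hf : NonConst f) (S : Finset ℂ) :
    ∑ a ∈ S, (locDegF f a - 1) ≤ (wronskian f.num f.denom).natDegree := by
  set W := wronskian f.num f.denom
  calc ∑ a ∈ S, (locDegF f a - 1) ≤ ∑ a ∈ S, W.roots.count a :=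
        Finset.sum_le_sum fun a _ => by rw [count_roots]; exact locDegF_sub_one_le hf a
    _ ≤ ∑ a ∈ W.roots.toFinset, W.roots.count a := Finset.sum_le_sum_of_ne_zero fun a _ ha => by
        rwa [Multiset.mem_toFinset, ← Multiset.count_ne_zero]
    _ = Multiset.card W.roots := Multiset.toFinset_sum_count_eq _
    _ ≤ W.natDegree := card_roots' W

lemma sum_locDeg_sub_one_le {f : RatFunc ℂ} (hf : NonConst f) (T : Finset (OnePoint ℂ)) :
    ∑ z ∈ T, (locDeg f z - 1) ≤ 2 * (rdeg f - 1) := by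
  set S : Finset ℂ := T.preimage _ OnePoint.coe_injective.injOn with hS
  set F₀ : Finset (OnePoint ℂ) := S.map ⟨_, OnePoint.coe_injective⟩ with hF₀
  have hninf : ∞ ∉ F₀ := by simp [hF₀]
  have hsub : T ⊆ insert ∞ F₀ := by
    intro z hz
    induction z using OnePoint.rec with
    | infty => simp
    | coe a => simp [hF₀, hS, hz]
  refine (Finset.sum_le_sum_of_subset hsub).trans ?_
  rw [Finset.sum_insert hninf, hF₀, Finset.sum_map]
  have h1 : ∑ a ∈ S, (locDeg f a - 1) ≤ _ := sum_locDegF_sub_one_le hf S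
  have hinf := evalOP_infty hf hf.one_le_rdeg (evalOP f ∞)
  have h2 := hinf.1.1 rfl
  have h3 := hinf.2 rfl
  have h4 : wronskian (fibPoly f (evalOP f ∞)) (cofibPoly f (evalOP f ∞)) ≠ 0 := by
    rcases wronskian_fibPoly f (evalOP f ∞) with h | h <;> simp [h, hf.wronskian_ne_zero]
  have h5 := natDegree_wronskian_lt_add h4
  rw [natDegree_wronskian_fibPoly] at h5
  have h6 := natDegree_cofibPoly_le f (evalOP f ∞)
  simp only [Function.Embedding.coeFn_mk]
  omega

lemma branchData {f : RatFunc ℂ} (hd : 2 ≤ rdeg f) :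
    BranchData (evalOP f) (locDeg f) (rdeg f) :=
  have hf : NonConst f := nonConst_of_one_le (by omega)
  ⟨hd, one_le_locDeg hf, exists_fiber hf, sum_locDeg_sub_one_le hf⟩

lemma NonConst.evalOP_eq_of_regAt {f : RatFunc ℂ} (hf : NonConst f) {a : ℂ} {c : OnePoint ℂ}
    (h : RegAt a 0 (coordAt c f)) : evalOP f a = c := by
  have key : ∀ b : ℂ, RegAt a 0 (f - RatFunc.C b) → ¬ RegAt a 0 f⁻¹ := by
    intro b h1 h2
    have h3 := h1.add (regAt_C a b)
    rw [sub_add_cancel] at h3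
    have h4 := h3.mul h2
    rw [mul_inv_cancel₀ hf.ne_zero, mul_zero] at h4
    have h5 := regAt_C a 1
    rw [map_one] at h5
    exact zero_ne_one (h4.unique h5)
  have h' : RegAt a 0 (coordAt (evalOP f a) f) := (hf.locF a).regAt_coordAt
  generalize evalOP f a = c' at h'
  induction c using OnePoint.rec with
  | infty =>
    induction c' using OnePoint.rec with
    | infty => rfl
    | coe c' => exact absurd h (key _ h')
  | coe c =>
    induction c' using OnePoint.rec with
    | infty => exact absurd h' (key _ h)
    | coe c' =>
      have h1 := h.add (regAt_C a c)
      have h2 := h'.add (regAt_C a c')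
      rw [coordAt_coe, sub_add_cancel, zero_add] at h1 h2
      rw [h1.unique h2]

lemma evalOP_inv_X_infty : evalOP (RatFunc.X : RatFunc ℂ)⁻¹ ∞ = ((0 : ℂ) : OnePoint ℂ) := by
  change evalOP (flip (RatFunc.X : RatFunc ℂ)⁻¹) ((0 : ℂ) : OnePoint ℂ) = _
  rw [flip_eq, map_inv₀, compHom_X, inv_inv]
  exact ((loc_X _).eq nonConst_X).1

lemma evalOP_inv_X_zero : evalOP (RatFunc.X : RatFunc ℂ)⁻¹ ((0 : ℂ) : OnePoint ℂ) = ∞ := by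
  refine nonConst_X.inv.evalOP_eq_of_regAt ?_
  simpa using regAt_X_sub_C 0

lemma evalOP_algebraMap_coe (p : ℂ[X]) (a : ℂ) :
    evalOP (algebraMap ℂ[X] (RatFunc ℂ) p) a = ((p.eval a : ℂ) : OnePoint ℂ) := by
  change evalF _ a = _
  simp [evalF]

lemma nonConst_algebraMap {p : ℂ[X]} (hp : 1 ≤ p.natDegree) :
    NonConst (algebraMap ℂ[X] (RatFunc ℂ) p) :=
  nonConst_of_one_le (by simpa [rdeg] using hp)

lemma evalOP_algebraMap_infty {p : ℂ[X]} (hp : 1 ≤ p.natDegree) :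
    evalOP (algebraMap ℂ[X] (RatFunc ℂ) p) ∞ = ∞ := by
  have hd : 1 ≤ rdeg (algebraMap ℂ[X] (RatFunc ℂ) p) := by simpa [rdeg] using hp
  refine (evalOP_infty (nonConst_algebraMap hp) hd ∞).1.2 ?_
  rwa [fibPoly_infty, RatFunc.denom_algebraMap, natDegree_one]

/-- `μ` and `ν` are mutually inverse Möbius transformations. -/
structure Mob (μ ν : RatFunc ℂ) : Prop where
  left : NonConst μ
  right : NonConst ν
  left_right : rcomp μ ν = RatFunc.X
  right_left : rcomp ν μ = RatFunc.X

namespace Mob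

variable {μ ν μ' ν' A B : RatFunc ℂ}

lemma symm (h : Mob μ ν) : Mob ν μ := ⟨h.2, h.1, h.4, h.3⟩

lemma trans (h : Mob μ ν) (h' : Mob μ' ν') : Mob (rcomp μ μ') (rcomp ν' ν) where
  left := h.1.rcomp h'.1
  right := h'.2.rcomp h.2
  left_right := by
    rw [rcomp_assoc _ (h'.2.rcomp h.2), ← rcomp_assoc μ' h.2, h'.3, rcomp_X, h.3]
  right_left := by
    rw [rcomp_assoc _ (h.1.rcomp h'.1), ← rcomp_assoc ν h'.1, h.4, rcomp_X, h'.4]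

lemma evalOP_evalOP (h : Mob μ ν) (x : OnePoint ℂ) : evalOP μ (evalOP ν x) = x := by
  rw [← evalOP_rcomp h.1 h.2, h.3]
  exact ((loc_X x).eq nonConst_X).1

lemma injective (h : Mob μ ν) : Function.Injective (evalOP ν) :=
  Function.LeftInverse.injective h.evalOP_evalOP

lemma locDeg_eq_one (h : Mob μ ν) (x : OnePoint ℂ) : locDeg ν x = 1 := by
  have h1 := locDeg_rcomp h.1 h.2 x
  rw [h.3, ((loc_X x).eq nonConst_X).2] at h1
  exact Nat.eq_one_of_mul_eq_one_left h1.symm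

lemma inv_X : Mob (RatFunc.X)⁻¹ (RatFunc.X)⁻¹ := by
  have : rcomp (RatFunc.X : RatFunc ℂ)⁻¹ (RatFunc.X)⁻¹ = RatFunc.X := by
    rw [rcomp_eq _ nonConst_X.inv, map_inv₀, compHom_X, inv_inv]
  exact ⟨nonConst_X.inv, nonConst_X.inv, this, this⟩

lemma affine {α : ℂ} (hα : α ≠ 0) (β : ℂ) :
    Mob (algebraMap ℂ[X] (RatFunc ℂ) (C α⁻¹ * X + C (-(α⁻¹ * β))))
      (algebraMap ℂ[X] (RatFunc ℂ) (C α * X + C β)) where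
  left := nonConst_algebraMap (natDegree_linear (inv_ne_zero hα)).ge
  right := nonConst_algebraMap (natDegree_linear hα).ge
  left_right := by
    rw [rcomp_algebraMap]
    have h : RatFunc.C α⁻¹ * RatFunc.C α = 1 := by rw [← map_mul, inv_mul_cancel₀ hα, map_one]
    simp only [map_add, map_mul, Polynomial.aeval_C, Polynomial.aeval_X, RatFunc.algebraMap_C,
      RatFunc.algebraMap_X, RatFunc.algebraMap_eq_C, map_neg]
    linear_combination RatFunc.X * h
  right_left := by
    rw [rcomp_algebraMap]
    have h : RatFunc.C α⁻¹ * RatFunc.C α = 1 := by rw [← map_mul, inv_mul_cancel₀ hα, map_one]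
    simp only [map_add, map_mul, Polynomial.aeval_C, Polynomial.aeval_X, RatFunc.algebraMap_C,
      RatFunc.algebraMap_X, RatFunc.algebraMap_eq_C, map_neg]
    linear_combination (RatFunc.X - RatFunc.C β) * h

lemma exists_infty (c : OnePoint ℂ) : ∃ μ ν, Mob μ ν ∧ evalOP ν c = ∞ := by
  induction c using OnePoint.rec with
  | infty =>
    exact ⟨_, _, affine one_ne_zero 0, evalOP_algebraMap_infty (natDegree_linear one_ne_zero).ge⟩
  | coe c =>
    have h := affine one_ne_zero (-c)
    refine ⟨_, _, h.trans inv_X, ?_⟩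
    rw [evalOP_rcomp inv_X.2 h.2, evalOP_algebraMap_coe]
    simp [evalOP_inv_X_zero]

/-- Postcomposing with an affine map. -/
lemma trans_affine (h : Mob μ ν) {α : ℂ} (hα : α ≠ 0) (β : ℂ) :
    ∃ μ' ν', Mob μ' ν' ∧ (∀ x, evalOP ν x = ∞ → evalOP ν' x = ∞) ∧
      ∀ x (z : ℂ), evalOP ν x = z → evalOP ν' x = ((α * z + β : ℂ) : OnePoint ℂ) := by
  have h' := affine hα β
  refine ⟨_, _, h.trans h', fun x hx => ?_, fun x z hx => ?_⟩
  · rw [evalOP_rcomp h'.2 h.2, hx, evalOP_algebraMap_infty (natDegree_linear hα).ge]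
  · rw [evalOP_rcomp h'.2 h.2, hx, evalOP_algebraMap_coe]
    simp

lemma exists_coe (h : Mob μ ν) {a b : OnePoint ℂ} (ha : evalOP ν a = ∞) (hb : a ≠ b) :
    ∃ z : ℂ, evalOP ν b = z := by
  have : evalOP ν b ≠ ∞ := fun hb' => hb (h.injective (ha.trans hb'.symm))
  obtain ⟨z, hz⟩ := OnePoint.ne_infty_iff_exists.1 this
  exact ⟨z, hz.symm⟩

lemma exists_infty_zero {a b : OnePoint ℂ} (hab : a ≠ b) :
    ∃ μ ν, Mob μ ν ∧ evalOP ν a = ∞ ∧ evalOP ν b = ((0 : ℂ) : OnePoint ℂ) := by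
  obtain ⟨μ, ν, h, ha⟩ := exists_infty a
  obtain ⟨z, hz⟩ := h.exists_coe ha hab
  obtain ⟨μ', ν', h', h1, h2⟩ := h.trans_affine one_ne_zero (-z)
  exact ⟨μ', ν', h', h1 a ha, by simpa using h2 b z hz⟩

lemma exists_infty_one_neg_one {c a b : OnePoint ℂ} (hca : c ≠ a) (hcb : c ≠ b) (hab : a ≠ b) :
    ∃ μ ν, Mob μ ν ∧ evalOP ν c = ∞ ∧ evalOP ν a = ((1 : ℂ) : OnePoint ℂ) ∧
      evalOP ν b = ((-1 : ℂ) : OnePoint ℂ) := by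
  obtain ⟨μ, ν, h, hc⟩ := exists_infty c
  obtain ⟨z, hz⟩ := h.exists_coe hc hca
  obtain ⟨w, hw⟩ := h.exists_coe hc hcb
  have hzw : z - w ≠ 0 := by
    rw [sub_ne_zero]
    rintro rfl
    exact hab (h.injective (hz.trans hw.symm))
  obtain ⟨μ', ν', h', h1, h2⟩ :=
    h.trans_affine (div_ne_zero two_ne_zero hzw) (-(z + w) / (z - w))
  refine ⟨μ', ν', h', h1 c hc, ?_, ?_⟩
  · rw [h2 a z hz]
    congr 1
    field_simp
    ring
  · rw [h2 b w hw]
    congr 1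
    field_simp
    ring

lemma nonConst_conj (h : Mob μ ν) (hA : NonConst A) :
    NonConst (rcomp (rcomp ν A) μ) := (h.2.rcomp hA).rcomp h.1

lemma evalOP_conj (h : Mob μ ν) (hA : NonConst A) (x : OnePoint ℂ) :
    evalOP (rcomp (rcomp ν A) μ) (evalOP ν x) = evalOP ν (evalOP A x) := by
  rw [evalOP_rcomp (h.2.rcomp hA) h.1, h.evalOP_evalOP, evalOP_rcomp h.2 hA]

lemma locDeg_conj (h : Mob μ ν) (hA : NonConst A) (x : OnePoint ℂ) :
    locDeg (rcomp (rcomp ν A) μ) (evalOP ν x) = locDeg A x := by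
  rw [locDeg_rcomp (h.2.rcomp hA) h.1, h.evalOP_evalOP, locDeg_rcomp h.2 hA, h.locDeg_eq_one,
    h.symm.locDeg_eq_one]
  ring

lemma eq_conj (h : Mob μ ν) (hA : NonConst A) :
    A = rcomp (rcomp μ (rcomp (rcomp ν A) μ)) ν := by
  rw [rcomp_assoc _ h.2, rcomp_assoc (rcomp ν A) h.2, h.3, rcomp_X_right,
    ← rcomp_assoc μ hA, h.3, rcomp_X]

lemma conjugate_conj (h : Mob μ ν) (hA : NonConst A) :
    Conjugate A (rcomp (rcomp ν A) μ) :=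
  ⟨μ, ν, h.3, h.4, h.eq_conj hA⟩

lemma conjugate_of_conj_eq (h : Mob μ ν) (hA : NonConst A) (h' : Mob μ' ν')
    (hB : NonConst B) (hAB : rcomp (rcomp ν A) μ = rcomp (rcomp μ' B) ν') : Conjugate A B := by
  have h2 := h.trans h'
  refine ⟨_, _, h2.3, h2.4, (h.eq_conj hA).trans ?_⟩
  rw [hAB, rcomp_assoc _ h.2, rcomp_assoc _ h.2, rcomp_assoc μ hB,
    rcomp_assoc μ (h'.2.rcomp h.2)]

end Mob

lemma exists_eq_algebraMap {f : RatFunc ℂ} (h : ∀ z : ℂ, evalOP f z ≠ ∞) :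
    ∃ p : ℂ[X], f = algebraMap ℂ[X] (RatFunc ℂ) p := by
  have hroot : ∀ z : ℂ, ¬ f.denom.IsRoot z := fun z hz =>
    h z ((evalF_eq_iff f z ∞).2 hz)
  have hdeg : f.denom.degree = 0 := by
    by_contra h0
    obtain ⟨z, hz⟩ := IsAlgClosed.exists_root f.denom h0
    exact hroot z hz
  have hone : f.denom = 1 := eq_one_of_monic_natDegree_zero f.monic_denom
    (natDegree_eq_of_degree_eq_some hdeg)
  refine ⟨f.num, ?_⟩
  nth_rw 1 [← RatFunc.num_div_denom f]
  rw [hone, map_one, div_one]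

lemma eq_C_mul_X_pow {f : RatFunc ℂ} (hf : NonConst f) {d : ℕ}
    (hinf : ∀ z : ℂ, evalOP f z ≠ ∞)
    (hzero : ∀ z : ℂ, evalOP f z = ((0 : ℂ) : OnePoint ℂ) ↔ z = 0)
    (hd : locDeg f ((0 : ℂ) : OnePoint ℂ) = d) :
    ∃ k : ℂ, k ≠ 0 ∧ f = RatFunc.C k * RatFunc.X ^ d := by
  obtain ⟨p, rfl⟩ := exists_eq_algebraMap hinf
  have hp : p ≠ 0 := by
    rintro rfl
    exact hf.ne_zero (map_zero _)
  have hroots : ∀ z ∈ p.roots, z = 0 := by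
    intro z hz
    rw [← hzero, evalOP_algebraMap_coe]
    rw [mem_roots hp, IsRoot.def] at hz
    rw [hz]
  have hcard : Multiset.card p.roots = d := by
    have h1 : locDegF (algebraMap ℂ[X] (RatFunc ℂ) p) 0 = d := hd
    have h2 : evalF (algebraMap ℂ[X] (RatFunc ℂ) p) 0 = ((0 : ℂ) : OnePoint ℂ) := (hzero 0).2 rfl
    rw [locDegF_eq, h2] at h1
    simp only [fibPoly_coe, RatFunc.num_algebraMap, map_zero, zero_mul, sub_zero] at h1
    rw [← h1, ← count_roots, eq_comm, Multiset.count_eq_card]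
    exact fun z hz => (hroots z hz).symm
  have hrep := Multiset.eq_replicate.2 ⟨hcard, hroots⟩
  refine ⟨p.leadingCoeff, leadingCoeff_ne_zero.2 hp, ?_⟩
  have h3 := (IsAlgClosed.splits p).eq_prod_roots
  rw [hrep] at h3
  nth_rw 1 [h3]
  simp

lemma conjugate_X_pow {A μ ν : RatFunc ℂ} (h : Mob μ ν) (hA : NonConst A) {d : ℕ} (hd : 2 ≤ d)
    {k : ℂ} (hk : k ≠ 0) (hAk : rcomp (rcomp ν A) μ = RatFunc.C k * RatFunc.X ^ d) :
    Conjugate A (RatFunc.X ^ d) := by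
  obtain ⟨l, hl⟩ := IsAlgClosed.exists_pow_nat_eq k⁻¹ (show 0 < d - 1 by omega)
  have hl0 : l ≠ 0 := by
    rintro rfl
    rw [zero_pow (by omega)] at hl
    exact inv_ne_zero hk hl.symm
  have h' := (Mob.affine hl0 0).symm
  have hB : NonConst (RatFunc.X ^ d : RatFunc ℂ) := by
    have := nonConst_algebraMap (p := X ^ d) (by rw [natDegree_X_pow]; omega)
    simpa using this
  refine h.conjugate_of_conj_eq hA h' hB (hAk.trans ?_)
  have hc : k = l * l⁻¹ ^ d := by
    rw [← inv_inv k, ← hl, inv_pow, show d = d - 1 + 1 by omega, pow_succ, mul_inv]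
    field_simp
    simp
  have h1 : Polynomial.aeval (RatFunc.X ^ d : RatFunc ℂ) (C l * X + C 0) =
      RatFunc.C l * RatFunc.X ^ d := by simp [RatFunc.algebraMap_eq_C]
  rw [rcomp_algebraMap, h1, rcomp_eq _ h'.2, map_mul, map_pow, compHom_C, compHom_X, hc, map_mul]
  simp [mul_pow, mul_assoc]

lemma conjugate_X_pow_inv {A μ ν : RatFunc ℂ} (h : Mob μ ν) (hA : NonConst A) {d : ℕ}
    (hd : 2 ≤ d) {k : ℂ} (hk : k ≠ 0)
    (hAk : rcomp (rcomp ν A) μ = (RatFunc.C k * RatFunc.X ^ d)⁻¹) :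
    Conjugate A (RatFunc.X ^ d)⁻¹ := by
  obtain ⟨l, hl⟩ := IsAlgClosed.exists_pow_nat_eq k⁻¹ (show 0 < d + 1 by omega)
  have hl0 : l ≠ 0 := by
    rintro rfl
    rw [zero_pow (by omega)] at hl
    exact inv_ne_zero hk hl.symm
  have h' := (Mob.affine hl0 0).symm
  have hB : NonConst (RatFunc.X ^ d : RatFunc ℂ) := by
    have := nonConst_algebraMap (p := X ^ d) (by rw [natDegree_X_pow]; omega)
    simpa using this
  refine h.conjugate_of_conj_eq hA h' hB.inv (hAk.trans ?_)
  have hki : (RatFunc.C k)⁻¹ = RatFunc.C l ^ d * RatFunc.C l := by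
    rw [← map_inv₀, ← hl, pow_succ, map_mul, map_pow]
  have h1 : Polynomial.aeval (RatFunc.X ^ d : RatFunc ℂ)⁻¹ (C l * X + C 0) =
      RatFunc.C l * (RatFunc.X ^ d)⁻¹ := by simp [RatFunc.algebraMap_eq_C]
  rw [rcomp_algebraMap, h1, rcomp_eq _ h'.2, map_mul, map_inv₀ (compHom _ h'.2) (RatFunc.X ^ d),
    map_pow, compHom_C, compHom_X, mul_inv, hki]
  simp [mul_pow]
  ring

lemma conjugate_of_powerConfig {A : RatFunc ℂ} (hd : 2 ≤ rdeg A)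
    (hP : PowerConfig (evalOP A) (locDeg A) (rdeg A)) :
    Conjugate A (RatFunc.X ^ rdeg A) ∨ Conjugate A (RatFunc.X ^ rdeg A)⁻¹ := by
  have H := branchData hd
  have hA : NonConst A := nonConst_of_one_le (by omega)
  obtain ⟨a, b, hab, ha, hb, hfa, hfb⟩ := hP
  have hne : evalOP A a ≠ evalOP A b := fun h => hab (H.eq_of_deg hb h)
  obtain ⟨μ, ν, h, hνa, hνb⟩ := Mob.exists_infty_zero hab
  set B := rcomp (rcomp ν A) μ with hBdef
  have hB : NonConst B := h.nonConst_conj hA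
  have hlb : locDeg B ((0 : ℂ) : OnePoint ℂ) = rdeg A := by rw [← hνb, h.locDeg_conj hA, hb]
  have hval : ∀ x y : OnePoint ℂ, locDeg A x = rdeg A → evalOP A x = y → ∀ z,
      evalOP B z = evalOP ν y ↔ z = evalOP ν x := by
    intro x y hx hxy z
    obtain ⟨w, rfl⟩ : ∃ w, evalOP ν w = z := ⟨_, h.symm.evalOP_evalOP z⟩
    rw [h.evalOP_conj hA, h.injective.eq_iff, h.injective.eq_iff, ← hxy]
    exact ⟨H.eq_of_deg hx, fun h => by rw [h]⟩
  rcases hfa with hfa | hfa <;> rcases hfb with hfb | hfb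
  · exact absurd (hfa.trans hfb.symm) hne
  · left
    have h1 := hval a a ha hfa
    have h2 := hval b b hb hfb
    rw [hνa] at h1
    rw [hνb] at h2
    obtain ⟨k, hk, hBk⟩ := eq_C_mul_X_pow hB (fun z => by simp [h1]) (fun z => by simp [h2]) hlb
    exact conjugate_X_pow h hA hd hk hBk
  · right
    have h1 := hval a b ha hfa
    have h2 := hval b a hb hfb
    rw [hνa, hνb] at h1 h2
    have hinv : rcomp (RatFunc.X)⁻¹ B = B⁻¹ := by
      rw [rcomp_eq _ hB, map_inv₀, compHom_X]
    have hBi : ∀ z, evalOP B⁻¹ z = evalOP (RatFunc.X)⁻¹ (evalOP B z) := fun z => by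
      rw [← hinv, evalOP_rcomp nonConst_X.inv hB]
    obtain ⟨k, hk, hBk⟩ := eq_C_mul_X_pow hB.inv
      (fun z => by
        rw [hBi, ← evalOP_inv_X_zero, Mob.inv_X.injective.ne_iff, Ne, h1]
        simp)
      (fun z => by
        rw [hBi, ← evalOP_inv_X_infty, Mob.inv_X.injective.eq_iff, h2]
        simp)
      (by rw [← hinv, locDeg_rcomp nonConst_X.inv hB, Mob.inv_X.locDeg_eq_one, one_mul, hlb])
    exact conjugate_X_pow_inv h hA hd hk (by rw [← hBk, inv_inv])
  · exact absurd (hfa.trans hfb.symm) hne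

lemma chebyshev_pell (n : ℕ) :
    Chebyshev.T ℂ (n + 1 : ℤ) ^ 2 - 1 = (X ^ 2 - 1) * Chebyshev.U ℂ (n : ℤ) ^ 2 := by
  have h : ∀ m : ℤ, Chebyshev.T ℂ (m + 1) = X * Chebyshev.T ℂ m - (1 - X ^ 2) *
      Chebyshev.U ℂ (m - 1) := fun m => by
    have := Chebyshev.T_eq_X_mul_T_sub_pol_U ℂ (m - 1)
    rwa [show m - 1 + 2 = m + 1 by ring, show m - 1 + 1 = m by ring] at this
  have h' : ∀ m : ℤ, Chebyshev.U ℂ m = X * Chebyshev.U ℂ (m - 1) + Chebyshev.T ℂ m := fun m => by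
    have := Chebyshev.U_eq_X_mul_U_add_T ℂ (m - 1)
    rwa [show m - 1 + 1 = m by ring] at this
  induction n with
  | zero => simp
  | succ n ih =>
    have h1 := h (n + 1)
    have h2 := h' (n + 1)
    rw [add_sub_cancel_right] at h1 h2
    push_cast
    rw [h1, h2]
    linear_combination ih

lemma exists_eq_sq {S : ℂ[X]} (hS : ∀ r, Even (rootMultiplicity r S)) : ∃ R, S = R ^ 2 := by
  choose m hm using hS
  obtain ⟨l, hl⟩ := IsAlgClosed.exists_pow_nat_eq S.leadingCoeff (show 0 < 2 by norm_num)
  refine ⟨C l * ∏ r ∈ S.roots.toFinset, (X - C r) ^ m r, ?_⟩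
  nth_rw 1 [(IsAlgClosed.splits S).eq_prod_roots]
  rw [Finset.prod_multiset_map_count, mul_pow, ← map_pow, hl, ← Finset.prod_pow]
  congr 1
  refine Finset.prod_congr rfl fun r _ => ?_
  rw [count_roots, hm, ← pow_mul, mul_two]

lemma sq_eq_of_pell {P R T U : ℂ[X]} {d : ℕ} (hd : 1 ≤ d) (hP : P.natDegree = d)
    (hU : U.natDegree = d - 1) (hU0 : U ≠ 0) (hPR : P ^ 2 - 1 = (X ^ 2 - 1) * R ^ 2)
    (hTU : T ^ 2 - 1 = (X ^ 2 - 1) * U ^ 2) : P = T ∨ P = -T := by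
  have hX : (X ^ 2 - 1 : ℂ[X]).natDegree = 2 := natDegree_X_pow_sub_C (n := 2) (r := (1 : ℂ))
  have hX0 : (X ^ 2 - 1 : ℂ[X]) ≠ 0 := by
    intro h
    simp [h] at hX
  have hP2 : (P ^ 2 - 1).natDegree = 2 * d := by
    have := natDegree_sub_C (p := P ^ 2) (a := 1)
    rwa [map_one, natDegree_pow, hP] at this
  have hR0 : R ≠ 0 := by
    rintro rfl
    rw [hPR] at hP2
    simp at hP2
    omega
  have hR : R.natDegree = d - 1 := by
    rw [hPR, natDegree_mul hX0 (pow_ne_zero _ hR0), hX, natDegree_pow] at hP2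
    omega
  have hfac : (P * U - T * R) * (P * U + T * R) = U ^ 2 - R ^ 2 := by
    refine mul_left_cancel₀ hX0 ?_
    linear_combination (T ^ 2 - 1) * hPR - (P ^ 2 - 1) * hTU
  suffices h : (P * U - T * R) * (P * U + T * R) = 0 by
    rw [h] at hfac
    have h2 : P ^ 2 = T ^ 2 := by linear_combination hPR - hTU + (X ^ 2 - 1) * hfac
    exact sq_eq_sq_iff_eq_or_eq_neg.1 h2
  by_contra h
  have h1 := natDegree_mul (left_ne_zero_of_mul h) (right_ne_zero_of_mul h)
  have h2 : (U ^ 2 - R ^ 2).natDegree ≤ 2 * (d - 1) := by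
    refine natDegree_sub_le_of_le ?_ ?_ |>.trans (max_self _).le
    · rw [natDegree_pow, hU]
    · rw [natDegree_pow, hR]
  have hP0 : P ≠ 0 := by
    rintro rfl
    simp at hP
    omega
  have h3 : ((P * U - T * R) + (P * U + T * R)).natDegree = d + (d - 1) := by
    rw [show (P * U - T * R) + (P * U + T * R) = C 2 * (P * U) by rw [C_ofNat]; ring,
      natDegree_C_mul two_ne_zero, natDegree_mul hP0 hU0, hP, hU]
  have h4 := natDegree_add_le (P * U - T * R) (P * U + T * R)
  rw [hfac] at h1
  omega

lemma rootMultiplicity_sq_sub_one (P : ℂ[X]) (r : ℂ) (h : P ^ 2 - 1 ≠ 0) :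
    rootMultiplicity r (P ^ 2 - 1) =
      rootMultiplicity r (P - C 1) + rootMultiplicity r (P - C (-1)) := by
  have : P ^ 2 - 1 = (P - C 1) * (P - C (-1)) := by simp; ring
  rw [this] at h ⊢
  exact rootMultiplicity_mul h

lemma eq_cheby {B : RatFunc ℂ} {d : ℕ} (hd : 1 ≤ d) (hB : NonConst B)
    (hfin : ∀ z : ℂ, evalOP B z ≠ ∞) (hinf : evalOP B ∞ = ∞) (hdeg : locDeg B ∞ = d)
    (h : ∀ z : ℂ, (z = 1 ∨ z = -1 →
        (evalOP B z = ((1 : ℂ) : OnePoint ℂ) ∨ evalOP B z = ((-1 : ℂ) : OnePoint ℂ)) ∧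
          locDeg B z = 1) ∧
      ((evalOP B z = ((1 : ℂ) : OnePoint ℂ) ∨ evalOP B z = ((-1 : ℂ) : OnePoint ℂ)) →
        (z = 1 ∨ z = -1) ∨ locDeg B z = 2)) :
    B = chebyRF d ∨ B = -chebyRF d := by
  obtain ⟨P, rfl⟩ := exists_eq_algebraMap hfin
  have hP : P.natDegree = d := by
    rw [← hdeg, (evalOP_infty hB hB.one_le_rdeg ∞).2 hinf]
    simp [rdeg]
  have hP2 : P ^ 2 - 1 ≠ 0 := by
    intro h0
    have := natDegree_sub_C (p := P ^ 2) (a := 1)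
    rw [map_one, h0, natDegree_pow, natDegree_zero] at this
    omega
  have hloc : ∀ r v : ℂ, P.eval r = v →
      rootMultiplicity r (P - C v) = locDeg (algebraMap ℂ[X] (RatFunc ℂ) P) r := by
    intro r v hv
    change _ = locDegF _ r
    have : evalF (algebraMap ℂ[X] (RatFunc ℂ) P) r = v := by
      rw [← hv]; exact evalOP_algebraMap_coe P r
    rw [locDegF_eq, this]
    simp
  have hloc0 : ∀ r v : ℂ, P.eval r ≠ v → rootMultiplicity r (P - C v) = 0 := by
    intro r v hv
    exact rootMultiplicity_eq_zero (by simpa [sub_eq_zero] using hv)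
  have hmult : ∀ r : ℂ, rootMultiplicity r (P ^ 2 - 1) =
      if P.eval r = 1 ∨ P.eval r = -1 then locDeg (algebraMap ℂ[X] (RatFunc ℂ) P) r else 0 := by
    intro r
    rw [rootMultiplicity_sq_sub_one P r hP2]
    split_ifs with hr
    · rcases hr with hr | hr
      · rw [hloc r 1 hr, hloc0 r (-1) (by rw [hr]; norm_num), add_zero]
      · rw [hloc r (-1) hr, hloc0 r 1 (by rw [hr]; norm_num), zero_add]
    · push Not at hr
      rw [hloc0 r 1 hr.1, hloc0 r (-1) hr.2]
  simp only [evalOP_algebraMap_coe, OnePoint.coe_eq_coe] at h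
  have hX1 : ((X : ℂ[X]) ^ 2 - 1) ≠ 0 := by
    intro h0
    have := natDegree_X_pow_sub_C (n := 2) (r := (1 : ℂ))
    rw [map_one, h0] at this
    simp at this
  have hX2 : ∀ r : ℂ, rootMultiplicity r ((X : ℂ[X]) ^ 2 - 1) =
      if r = 1 ∨ r = -1 then 1 else 0 := by
    intro r
    rw [rootMultiplicity_sq_sub_one X r hX1, rootMultiplicity_X_sub_C, rootMultiplicity_X_sub_C]
    by_cases h1 : r = 1
    · subst h1; norm_num
    · simp [h1]
  have hdvd : (X : ℂ[X]) ^ 2 - 1 ∣ P ^ 2 - 1 := by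
    have : (X : ℂ[X]) ^ 2 - 1 = (X - C 1) * (X - C (-1)) := by simp; ring
    rw [this]
    refine IsCoprime.mul_dvd (isCoprime_X_sub_C_of_isUnit_sub (by norm_num)) ?_ ?_ <;>
      rw [dvd_iff_isRoot, IsRoot.def, eval_sub, eval_pow, eval_one]
    · rcases ((h 1).1 (by simp)).1 with h1 | h1 <;> rw [h1] <;> norm_num
    · rcases ((h (-1)).1 (by simp)).1 with h1 | h1 <;> rw [h1] <;> norm_num
  obtain ⟨S, hS⟩ := hdvd
  obtain ⟨R, rfl⟩ : ∃ R, S = R ^ 2 := by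
    refine exists_eq_sq fun r => ?_
    have h1 := hmult r
    rw [hS, rootMultiplicity_mul (hS ▸ hP2), hX2] at h1
    by_cases hr : r = 1 ∨ r = -1
    · have h2 := (h r).1 hr
      rw [if_pos hr, if_pos h2.1, h2.2] at h1
      rw [show rootMultiplicity r S = 0 by omega]
      exact Even.zero
    · rw [if_neg hr, zero_add] at h1
      rw [h1]
      split_ifs with h3
      · rw [((h r).2 h3).resolve_left hr]
        exact even_two
      · exact Even.zero
  obtain ⟨n, rfl⟩ : ∃ n, d = n + 1 := ⟨d - 1, by omega⟩
  have hU0 : Chebyshev.U ℂ (n : ℤ) ≠ 0 := by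
    rw [← leadingCoeff_ne_zero, Chebyshev.leadingCoeff_U_natCast]
    exact pow_ne_zero _ two_ne_zero
  have hT := chebyshev_pell n
  rcases sq_eq_of_pell hd hP (by simp) hU0 hS hT with h1 | h1
  · left; rw [chebyRF, h1]; push_cast; rfl
  · right; rw [chebyRF, h1, map_neg]; push_cast; rfl

lemma conjugate_of_chebyConfig {A : RatFunc ℂ} (hd : 2 ≤ rdeg A)
    (hC : ChebyConfig (evalOP A) (locDeg A) (rdeg A)) :
    Conjugate A (chebyRF (rdeg A)) ∨ Conjugate A (-chebyRF (rdeg A)) := by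
  have H := branchData hd
  have hA : NonConst A := nonConst_of_one_le (by omega)
  obtain ⟨c, a, b, hab, hac, hbc, hfc, hec, hz⟩ := hC
  obtain ⟨μ, ν, h, hνc, hνa, hνb⟩ := Mob.exists_infty_one_neg_one hac.symm hbc.symm hab
  have hfin : ∀ z : ℂ, evalOP (rcomp (rcomp ν A) μ) z ≠ ∞ := by
    intro z hz
    rw [← h.symm.evalOP_evalOP z, h.evalOP_conj hA, ← hνc, h.injective.eq_iff] at hz
    have h1 := H.eq_of_deg hec (hz.trans hfc.symm)
    have h2 := h.symm.evalOP_evalOP z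
    rw [h1, hνc] at h2
    exact OnePoint.infty_ne_coe _ h2
  have hval : ∀ z : ℂ, (z = 1 ∨ z = -1 →
      (evalOP (rcomp (rcomp ν A) μ) z = ((1 : ℂ) : OnePoint ℂ) ∨
        evalOP (rcomp (rcomp ν A) μ) z = ((-1 : ℂ) : OnePoint ℂ)) ∧
          locDeg (rcomp (rcomp ν A) μ) z = 1) ∧
      ((evalOP (rcomp (rcomp ν A) μ) z = ((1 : ℂ) : OnePoint ℂ) ∨
        evalOP (rcomp (rcomp ν A) μ) z = ((-1 : ℂ) : OnePoint ℂ)) →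
        (z = 1 ∨ z = -1) ∨ locDeg (rcomp (rcomp ν A) μ) z = 2) := by
    intro z
    have h1 := hz (evalOP μ z)
    rw [← OnePoint.coe_eq_coe (x := z) (y := 1), ← OnePoint.coe_eq_coe (x := z) (y := -1),
      ← h.symm.evalOP_evalOP z, h.evalOP_conj hA, h.locDeg_conj hA, ← hνa, ← hνb,
      h.injective.eq_iff, h.injective.eq_iff, h.injective.eq_iff, h.injective.eq_iff]
    exact h1
  have hinf : evalOP (rcomp (rcomp ν A) μ) ∞ = ∞ := by
    rw [← hνc, h.evalOP_conj hA, hfc]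
  have hdeg : locDeg (rcomp (rcomp ν A) μ) ∞ = rdeg A := by
    rw [← hνc, h.locDeg_conj hA, hec]
  have hconj := h.conjugate_conj hA
  rcases eq_cheby (by omega) (h.nonConst_conj hA) hfin hinf hdeg hval with h1 | h1 <;>
    rw [h1] at hconj
  · exact Or.inl hconj
  · exact Or.inr hconj

end GenLattes

namespace GenLattes

/-- **Theorem (existence of the maximal orbifold `O₀^A`).**
If `A` is a rational map of degree `d ≥ 2` not conjugate to `z^d`, `z^{-d}`, `T_d`, `-T_d`,
then there is an orbifold `O₀` such that `A : O₀ → O₀` is a minimal holomorphic map, every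
orbifold `O` with `A : O → O` minimal holomorphic satisfies `O ⪯ O₀`, and moreover for every
`l ≥ 1` the same `O₀` is the maximal orbifold for the iterate `A^{∘l}`. -/
theorem maximal_orbifold_exists (A : RatFunc ℂ) (d : ℕ) (hd : 2 ≤ d) (hdeg : rdeg A = d)
    (h1 : ¬ Conjugate A (RatFunc.X ^ d))
    (h2 : ¬ Conjugate A ((RatFunc.X ^ d)⁻¹))
    (h3 : ¬ Conjugate A (chebyRF d))
    (h4 : ¬ Conjugate A (-(chebyRF d))) :
    ∃ O₀ : Orbifold, O₀.Good ∧ IsMinHolo A O₀ O₀ ∧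
      (∀ O : Orbifold, O.Good → IsMinHolo A O O → O.Prec O₀) ∧
      (∀ l : ℕ, 1 ≤ l →
        IsMinHolo (riter A l) O₀ O₀ ∧
        ∀ O : Orbifold, O.Good → IsMinHolo (riter A l) O O → O.Prec O₀) := by
  subst hdeg
  have H := branchData hd
  have hA : NonConst A := nonConst_of_one_le (by omega)
  have hP : ¬ PowerConfig (evalOP A) (locDeg A) (rdeg A) := fun h =>
    (conjugate_of_powerConfig hd h).elim h1 h2
  have hC : ¬ ChebyConfig (evalOP A) (locDeg A) (rdeg A) := fun h =>
    (conjugate_of_chebyConfig hd h).elim h3 h4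
  obtain ⟨O₀, hgood, hmin, hmax⟩ := H.exists_maximal hP hC
  refine ⟨O₀, hgood, (minFun_iff_isMinHolo A (one_le_locDeg hA) O₀ O₀).1 hmin,
    fun O hO h => hmax O hO ((minFun_iff_isMinHolo A (one_le_locDeg hA) O O).2 h),
    fun l hl => ?_⟩
  have hiter : ∀ O : Orbifold, MinFun (evalOP A)^[l]
      (BranchData.iterDeg (evalOP A) (locDeg A) l) O.nu O.nu ↔ IsMinHolo (riter A l) O O := by
    intro O
    rw [← evalOP_riter hA, ← locDeg_riter hA]
    exact minFun_iff_isMinHolo _ (one_le_locDeg (hA.riter l)) O O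
  refine ⟨(hiter O₀).1 (BranchData.minFun_iterate hmin l), fun O hO h => ?_⟩
  obtain ⟨O', hO', hmin', hle⟩ := H.exists_good_of_iterate hO hl ((hiter O).2 h)
  exact fun z => (hle z).trans (hmax O' hO' hmin' z)

end GenLattes
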